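/- Let Ω ⊆ ℝ² be open and u : Ω → ℝ a smooth function with 0 < A := ∫_Ω e^{2u(x)} dx < ∞. Then for every smooth compactly supported map φ : Ω → ℂ² one has ∫_Ω e^{−u(x)}‖Dφ(x)‖² dx ≥ (4π/A) · ∫_Ω e^{u(x)}‖φ(x)‖² dx, where D is the flat planar Dirac operator. (By conformal covariance of the Dirac operator, this is exactly the bound λ_*(D²) ≥ 4π/area(M) of the paper's surface theorem for the genus-0 surface (Ω, e^{2u}(dx_1² + dx_2²)) of finite area A, whose spin structure is bounding at infinity.) -/

import Mathlib

open MeasureTheory Real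
open scoped ComplexInnerProductSpace

namespace DiracPlane

/-- twice the Cauchy-Riemann operator -/
noncomputable def db (f : ℂ → ℂ) (z : ℂ) : ℂ := fderiv ℝ f z 1 + Complex.I * fderiv ℝ f z Complex.I

/-- smooth compactly supported -/
def Test {F : Type*} [NormedAddCommGroup F] [NormedSpace ℝ F] (f : ℂ → F) : Prop :=
  ContDiff ℝ (⊤ : ℕ∞) f ∧ HasCompactSupport f

lemma smooth_fderiv {F : Type*} [NormedAddCommGroup F] [NormedSpace ℝ F] {f : ℂ → F}
    (hf : ContDiff ℝ (⊤ : ℕ∞) f) (e : ℂ) : ContDiff ℝ (⊤ : ℕ∞) (fun z => fderiv ℝ f z e) :=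
  (hf.fderiv_right (m := (⊤ : ℕ∞)) (by simp)).clm_apply contDiff_const

lemma smooth_db {f : ℂ → ℂ} (hf : ContDiff ℝ (⊤ : ℕ∞) f) : ContDiff ℝ (⊤ : ℕ∞) (db f) :=
  (smooth_fderiv hf 1).add (contDiff_const.mul (smooth_fderiv hf Complex.I))

lemma smooth_diff {F : Type*} [NormedAddCommGroup F] [NormedSpace ℝ F] {f : ℂ → F}
    (hf : ContDiff ℝ (⊤ : ℕ∞) f) : Differentiable ℝ f := hf.differentiable (by simp)

lemma Test.fderiv {F : Type*} [NormedAddCommGroup F] [NormedSpace ℝ F] {f : ℂ → F}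
    (hf : Test f) (e : ℂ) : Test (fun z => fderiv ℝ f z e) :=
  ⟨smooth_fderiv hf.1 e, hf.2.fderiv_apply (𝕜 := ℝ) e⟩

lemma Test.integrable {F : Type*} [NormedAddCommGroup F] [NormedSpace ℝ F] {f : ℂ → F}
    (hf : Test f) : Integrable f := hf.1.continuous.integrable_of_hasCompactSupport hf.2

lemma Test.db {f : ℂ → ℂ} (hf : Test f) : Test (db f) :=
  ⟨smooth_db hf.1, (hf.fderiv 1).2.add ((hf.fderiv Complex.I).2.mul_left)⟩

lemma Test.mul_left {f g : ℂ → ℂ} (hf : ContDiff ℝ (⊤ : ℕ∞) f) (hg : Test g) :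
    Test (fun z => f z * g z) := ⟨hf.mul hg.1, hg.2.mul_left⟩

lemma Test.int_fderiv {f : ℂ → ℂ} (hf : Test f) (e : ℂ) : ∫ z, _root_.fderiv ℝ f z e = 0 := by
  have := integral_mul_fderiv_eq_neg_fderiv_mul_of_integrable (μ := (volume : Measure ℂ))
    (f := fun _ : ℂ => (1 : ℂ)) (g := f) (v := e) (by simp)
    (by simpa using (hf.fderiv e).integrable) (by simpa using hf.integrable) (by simp)
    (fun x _ => smooth_diff hf.1 x)
  simpa using this

lemma line {F : Type*} [NormedAddCommGroup F] [NormedSpace ℝ F] {f : ℂ → F}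
    (hf : ContDiff ℝ (⊤ : ℕ∞) f) (z e : ℂ) :
    HasDerivAt (fun t : ℝ => f (z + t • e)) (fderiv ℝ f z e) 0 :=
  ((smooth_diff hf z).hasFDerivAt.hasLineDerivAt e)

lemma fderiv_eq_of_line {f : ℂ → ℂ} (hf : ContDiff ℝ (⊤ : ℕ∞) f) {z e d : ℂ}
    (h : HasDerivAt (fun t : ℝ => f (z + t • e)) d 0) : fderiv ℝ f z e = d :=
  (line hf z e).unique h

lemma smooth_conj {f : ℂ → ℂ} (hf : ContDiff ℝ (⊤ : ℕ∞) f) :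
    ContDiff ℝ (⊤ : ℕ∞) (fun z => (starRingEnd ℂ) (f z)) :=
  Complex.conjCLE.contDiff.comp hf

lemma fderiv_conj {f : ℂ → ℂ} (hf : ContDiff ℝ (⊤ : ℕ∞) f) (z e : ℂ) :
    fderiv ℝ (fun z => (starRingEnd ℂ) (f z)) z e = (starRingEnd ℂ) (fderiv ℝ f z e) :=
  fderiv_eq_of_line (smooth_conj hf)
    (Complex.conjCLE.toContinuousLinearMap.hasFDerivAt.comp_hasDerivAt 0 (line hf z e))

lemma smooth_ofReal {f : ℂ → ℝ} (hf : ContDiff ℝ (⊤ : ℕ∞) f) :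
    ContDiff ℝ (⊤ : ℕ∞) (fun z => (f z : ℂ)) :=
  Complex.ofRealCLM.contDiff.comp hf

lemma fderiv_ofReal {f : ℂ → ℝ} (hf : ContDiff ℝ (⊤ : ℕ∞) f) (z e : ℂ) :
    fderiv ℝ (fun z => (f z : ℂ)) z e = (fderiv ℝ f z e : ℝ) :=
  fderiv_eq_of_line (smooth_ofReal hf)
    (Complex.ofRealCLM.hasFDerivAt.comp_hasDerivAt 0 (line hf z e))

/-- the Laplacian -/
noncomputable def lap (f : ℂ → ℝ) (z : ℂ) : ℝ :=
  fderiv ℝ (fun w => fderiv ℝ f w 1) z 1 + fderiv ℝ (fun w => fderiv ℝ f w Complex.I) z Complex.I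

lemma snd_symm {F : Type*} [NormedAddCommGroup F] [NormedSpace ℝ F] {f : ℂ → F}
    (hf : ContDiff ℝ (⊤ : ℕ∞) f) (z d e : ℂ) :
    fderiv ℝ (fun w => fderiv ℝ f w d) z e = fderiv ℝ (fun w => fderiv ℝ f w e) z d := by
  have h1 : DifferentiableAt ℝ (fderiv ℝ f) z :=
    (hf.fderiv_right (m := (⊤ : ℕ∞)) (by simp)).differentiable (by simp) z
  have h2 := (hf.contDiffAt (x := z)).isSymmSndFDerivAt
    (by simpa using (WithTop.coe_le_coe.2 le_top : ((2 : ℕ∞) : WithTop ℕ∞) ≤ ((⊤ : ℕ∞) : WithTop ℕ∞)))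
  rw [fderiv_clm_apply h1 (by fun_prop), fderiv_clm_apply h1 (by fun_prop)]
  simpa using h2 e d

lemma basic_ineq {v : ℂ → ℂ} (hv : Test v) {ϕ : ℂ → ℝ} (hϕ : ContDiff ℝ (⊤ : ℕ∞) ϕ) :
    ∫ z, Real.exp (ϕ z) * lap ϕ z * ‖v z‖ ^ 2 ≤ ∫ z, Real.exp (ϕ z) * ‖db v z‖ ^ 2 := by
  set p : ℂ → ℂ := fun z => (ϕ z : ℂ) with hp
  have sp : ContDiff ℝ (⊤ : ℕ∞) p := smooth_ofReal hϕ
  set w : ℂ → ℂ := fun z => (starRingEnd ℂ) (v z) with hw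
  have sw : ContDiff ℝ (⊤ : ℕ∞) w := smooth_conj hv.1
  set I := Complex.I with hI
  have hII : I * I = -1 := Complex.I_mul_I
  set E : ℂ → ℂ := fun z => Complex.exp (p z) with hE
  have sE : ContDiff ℝ (⊤ : ℕ∞) E := Complex.contDiff_exp.comp sp
  have spx := smooth_fderiv sp 1
  have spy := smooth_fderiv sp I
  have svx := smooth_fderiv hv.1 1
  have svy := smooth_fderiv hv.1 I
  set F : ℂ → ℂ := fun z => (E z * (2 * I * w z * fderiv ℝ v z I
    - (fderiv ℝ p z 1 - I * fderiv ℝ p z I) * v z * w z)) with hF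
  set G : ℂ → ℂ := fun z => (E z * (-2 * I * w z * fderiv ℝ v z 1
    - I * (fderiv ℝ p z 1 - I * fderiv ℝ p z I) * v z * w z)) with hG
  have sF : ContDiff ℝ (⊤ : ℕ∞) F := by
    have := hv.1
    simp only [hF]; fun_prop
  have sG : ContDiff ℝ (⊤ : ℕ∞) G := by
    have := hv.1
    simp only [hG]; fun_prop
  have cw : HasCompactSupport w := hv.2.comp_left (g := starRingEnd ℂ) (by simp)
  have cF : HasCompactSupport F := by
    refine cw.mono fun z hz => ?_
    contrapose! hz
    have : w z = 0 := by simpa using hz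
    simp [hF, this]
  have cG : HasCompactSupport G := by
    refine cw.mono fun z hz => ?_
    contrapose! hz
    have : w z = 0 := by simpa using hz
    simp [hG, this]
  have TF : Test F := ⟨sF, cF⟩
  have TG : Test G := ⟨sG, cG⟩
  set B : ℂ → ℂ := fun z => fderiv ℝ v z 1 - I * fderiv ℝ v z I
    + (fderiv ℝ p z 1 - I * fderiv ℝ p z I) * v z with hB
  have key : ∀ z, fderiv ℝ F z 1 + fderiv ℝ G z I
      = ((Real.exp (ϕ z) * ‖db v z‖ ^ 2 - Real.exp (ϕ z) * ‖B z‖ ^ 2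
        - Real.exp (ϕ z) * lap ϕ z * ‖v z‖ ^ 2 : ℝ) : ℂ) := by
    intro z
    have hEl : ∀ e : ℂ, HasDerivAt (fun t : ℝ => E (z + t • e)) (E (z + (0:ℝ) • e) * fderiv ℝ p z e) 0 :=
      fun e => (line sp z e).cexp
    have dF : fderiv ℝ F z 1 = _ := fderiv_eq_of_line sF
      ((hEl 1).mul ((((line sw z 1).const_mul (2 * I)).mul (line svy z 1)).sub
        ((((line spx z 1).sub ((line spy z 1).const_mul I)).mul (line hv.1 z 1)).mul (line sw z 1))))
    have dG : fderiv ℝ G z I = _ := fderiv_eq_of_line sG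
      ((hEl I).mul ((((line sw z I).const_mul (-2 * I)).mul (line svx z I)).sub
        (((((line spx z I).sub ((line spy z I).const_mul I)).const_mul I).mul
          (line hv.1 z I)).mul (line sw z I))))
    rw [dF, dG]
    have e1 : ∀ x : ℂ, ((‖x‖ ^ 2 : ℝ) : ℂ) = x * (starRingEnd ℂ) x := fun x => by
      rw [Complex.mul_conj, Complex.normSq_eq_norm_sq]
    have e2 : ((Real.exp (ϕ z) : ℝ) : ℂ) = E z := by simp [hE, hp]
    have e3 : ((lap ϕ z : ℝ) : ℂ) = fderiv ℝ (fun w => fderiv ℝ p w 1) z 1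
        + fderiv ℝ (fun w => fderiv ℝ p w I) z I := by
      simp only [lap, hp, fderiv_ofReal hϕ]
      rw [fderiv_ofReal (smooth_fderiv hϕ 1), fderiv_ofReal (smooth_fderiv hϕ I)]
      push_cast; rfl
    have e4 : ∀ e, (starRingEnd ℂ) (fderiv ℝ p z e) = fderiv ℝ p z e := by
      intro e; simp only [hp, fderiv_ofReal hϕ]; exact Complex.conj_ofReal _
    have e5 : ∀ e, (starRingEnd ℂ) (fderiv ℝ v z e) = fderiv ℝ w z e := fun e =>
      (fderiv_conj hv.1 z e).symm
    rw [Complex.ofReal_sub, Complex.ofReal_sub, Complex.ofReal_mul, Complex.ofReal_mul,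
      Complex.ofReal_mul, Complex.ofReal_mul, e1, e1, e1, e2, e3]
    simp only [db, hB, map_add, map_mul, map_sub, e4, e5, zero_smul, add_zero, ← hI,
      Pi.mul_apply, Pi.sub_apply]
    have e6 : (starRingEnd ℂ) (v z) = w z := rfl
    have e7 : (starRingEnd ℂ) I = -I := Complex.conj_I
    rw [e6, e7, snd_symm hv.1 z I 1, snd_symm sp z I 1]
    linear_combination (E z * w z * v z * fderiv ℝ (fun z => fderiv ℝ p z I) z I) * hII
  have hz : ∫ z, (Real.exp (ϕ z) * ‖db v z‖ ^ 2 - Real.exp (ϕ z) * ‖B z‖ ^ 2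
        - Real.exp (ϕ z) * lap ϕ z * ‖v z‖ ^ 2) = 0 := by
    have : ∫ z, (fderiv ℝ F z 1 + fderiv ℝ G z I) = 0 := by
      rw [integral_add (TF.fderiv 1).integrable (TG.fderiv I).integrable, TF.int_fderiv, TG.int_fderiv,
        add_zero]
    simp_rw [key] at this
    exact Complex.ofReal_eq_zero.1 ((integral_ofReal (𝕜 := ℂ)).symm.trans this)
  have cϕ := hϕ.continuous
  have i1 : Integrable (fun z => Real.exp (ϕ z) * ‖db v z‖ ^ 2) := by
    refine Continuous.integrable_of_hasCompactSupport ?_ ?_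
    · have := hv.db.1.continuous; fun_prop
    · exact (hv.db.2.comp_left (g := fun x : ℂ => ‖x‖ ^ 2) (by simp)).mul_left
  have sB : Continuous B := by
    have := hv.1.continuous
    have := svx.continuous
    have := svy.continuous
    have := spx.continuous
    have := spy.continuous
    simp only [hB]; fun_prop
  have i2 : Integrable (fun z => Real.exp (ϕ z) * ‖B z‖ ^ 2) := by
    refine Continuous.integrable_of_hasCompactSupport (by fun_prop) ?_
    have : HasCompactSupport B := by
      exact ((hv.fderiv 1).2.sub ((hv.fderiv I).2.mul_left)).add (hv.2.mul_left)
    exact (this.comp_left (g := fun x : ℂ => ‖x‖ ^ 2) (by simp)).mul_left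
  have i3 : Integrable (fun z => Real.exp (ϕ z) * lap ϕ z * ‖v z‖ ^ 2) := by
    refine Continuous.integrable_of_hasCompactSupport ?_ ?_
    · have h1 := (smooth_fderiv (smooth_fderiv hϕ 1) 1).continuous
      have h2 := (smooth_fderiv (smooth_fderiv hϕ I) I).continuous
      have : Continuous (lap ϕ) := h1.add h2
      have := hv.1.continuous; fun_prop
    · exact (hv.2.comp_left (g := fun x : ℂ => ‖x‖ ^ 2) (by simp)).mul_left
  have hz2 := hz
  erw [integral_sub (i1.sub i2) i3, integral_sub i1 i2] at hz2
  have : 0 ≤ ∫ z, Real.exp (ϕ z) * ‖B z‖ ^ 2 := integral_nonneg fun z => by positivity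
  linarith

end DiracPlane
namespace DiracPlane

lemma locInt_inv : LocallyIntegrable (fun z : ℂ => ‖z‖⁻¹) := by
  rw [locallyIntegrable_iff]
  intro K hK
  obtain ⟨R, hR⟩ := hK.isBounded.subset_ball 0
  refine IntegrableOn.mono_set ?_ hR
  rw [integrableOn_fun_norm_addHaar (μ := (volume : Measure ℂ)) (f := fun y : ℝ => y⁻¹)]
  have : IntegrableOn (fun _ : ℝ => (1 : ℝ)) (Set.Ioo 0 R) := by simp
  refine this.congr_fun (fun y hy => ?_) measurableSet_Ioo
  have : y ≠ 0 := hy.1.ne'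
  simp [Complex.finrank_real_complex, this]

lemma locInt_cinv : LocallyIntegrable (fun z : ℂ => z⁻¹) := by
  refine locInt_inv.mono (by fun_prop) (.of_forall fun z => ?_)
  simp

lemma abs_log_le (r : ℝ) (hr : 0 ≤ r) : |Real.log r| ≤ r⁻¹ + r := by
  rcases hr.eq_or_lt with rfl | h
  · simp
  rw [abs_le]
  have h1 := Real.log_le_self hr
  have h2 := Real.log_le_self (inv_nonneg.2 hr)
  rw [Real.log_inv] at h2
  have := inv_pos.2 h
  constructor <;> linarith

lemma locInt_log : LocallyIntegrable (fun z : ℂ => Real.log ‖z‖) := by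
  refine (locInt_inv.add (continuous_norm.locallyIntegrable)).mono
    (Real.measurable_log.comp measurable_norm).aestronglyMeasurable (.of_forall fun z => ?_)
  have := abs_log_le ‖z‖ (norm_nonneg _)
  simp only [Pi.add_apply]
  rw [Real.norm_eq_abs, Real.norm_eq_abs]
  exact this.trans (le_abs_self _)

lemma LI_mul_test {A : Type*} [NormedRing A] [NormedAlgebra ℝ A] {κ f : ℂ → A}
    (hκ : LocallyIntegrable κ) (hf : Test f) : Integrable (fun z => κ z * f z) := by
  have h := hκ.integrable_smul_right_of_hasCompactSupport (𝕜 := A)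
    (f := κ) hf.1.continuous hf.2
  simpa using h

/-- polar integral of the radial derivative and angular derivative -/
lemma pompeiu0 {f : ℂ → ℂ} (hf : Test f) : ∫ z, z⁻¹ * db f z = -(2 * π) * f 0 := by
  set e : ℝ → ℂ := fun θ => (Real.cos θ + Real.sin θ * Complex.I) with he
  have ce : Continuous e := by simp only [he]; fun_prop
  have ne : ∀ θ, ‖e θ‖ = 1 := fun θ => by
    simp only [he, Complex.ofReal_cos, Complex.ofReal_sin]
    rw [← Complex.exp_mul_I, Complex.norm_exp_ofReal_mul_I]
  have e0 : ∀ θ, e θ ≠ 0 := fun θ h => by simpa [h] using ne θ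
  have cdf : Continuous (fderiv ℝ f) := hf.1.continuous_fderiv (by simp)
  set A : ℝ × ℝ → ℂ := fun p => fderiv ℝ f (p.1 * e p.2) (e p.2) with hA
  set B : ℝ × ℝ → ℂ := fun p => fderiv ℝ f (p.1 * e p.2) (Complex.I * e p.2) with hB
  have cA : Continuous A := by simp only [hA]; fun_prop
  have cB : Continuous B := by simp only [hB]; fun_prop
  obtain ⟨R, hR⟩ := (hf.2.fderiv (𝕜 := ℝ)).isCompact.isBounded.subset_closedBall 0
  have hz : ∀ p : ℝ × ℝ, |R| < p.1 → fderiv ℝ f (p.1 * e p.2) = 0 := by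
    intro p hp
    apply image_eq_zero_of_notMem_tsupport
    intro h
    have := hR h
    simp [ne] at this
    have := le_abs_self R
    have := le_abs_self p.1
    linarith
  have hint : ∀ H : ℝ × ℝ → ℂ, Continuous H → (∀ p : ℝ × ℝ, |R| < p.1 → H p = 0) →
      IntegrableOn H (Set.Ioi (0 : ℝ) ×ˢ Set.Ioo (-π) π) := by
    intro H cH hH
    have h1 : IntegrableOn H (Set.Icc (0 : ℝ) |R| ×ˢ Set.Icc (-π) π) :=
      cH.continuousOn.integrableOn_compact (isCompact_Icc.prod isCompact_Icc)
    refine h1.of_forall_sdiff_eq_zero (measurableSet_Ioi.prod measurableSet_Ioo) ?_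
    rintro ⟨r, θ⟩ ⟨⟨h1, h2⟩, h3⟩
    apply hH
    by_contra h4
    exact h3 ⟨⟨le_of_lt h1, not_lt.1 h4⟩, ⟨h2.1.le, h2.2.le⟩⟩
  have iA := hint A cA fun p hp => by simp [hA, hz p hp]
  have iB := hint B cB fun p hp => by simp [hB, hz p hp]
  rw [← Complex.integral_comp_polarCoord_symm, polarCoord_target]
  have hcong : ∫ p in Set.Ioi (0 : ℝ) ×ˢ Set.Ioo (-π) π,
      p.1 • ((Complex.polarCoord.symm p)⁻¹ * db f (Complex.polarCoord.symm p))
      = ∫ p in Set.Ioi (0 : ℝ) ×ˢ Set.Ioo (-π) π, (A p + Complex.I * B p) := by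
    refine setIntegral_congr_fun (measurableSet_Ioi.prod measurableSet_Ioo) ?_
    rintro ⟨r, θ⟩ ⟨hr, -⟩
    have hr : (r : ℂ) ≠ 0 := by exact_mod_cast (ne_of_gt hr)
    simp only [Complex.polarCoord_symm_apply, db, hA, hB]
    have h1 : (Real.cos θ : ℂ) + Real.sin θ * Complex.I = e θ := rfl
    rw [h1]
    have h2 : fderiv ℝ f (r * e θ) (e θ) = Real.cos θ * fderiv ℝ f (r * e θ) 1
        + Real.sin θ * fderiv ℝ f (r * e θ) Complex.I := by
      have : e θ = Real.cos θ • (1 : ℂ) + Real.sin θ • Complex.I := by simp [he]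
      conv_lhs => rw [this]
      rw [map_add, map_smul, map_smul]; simp [this]
    have h3 : fderiv ℝ f (r * e θ) (Complex.I * e θ) = - Real.sin θ * fderiv ℝ f (r * e θ) 1
        + Real.cos θ * fderiv ℝ f (r * e θ) Complex.I := by
      have : Complex.I * e θ = (- Real.sin θ) • (1 : ℂ) + Real.cos θ • Complex.I := by
        simp only [he, Complex.real_smul, Complex.ofReal_neg]
        linear_combination (Real.sin θ : ℂ) * Complex.I_mul_I
      conv_lhs => rw [this]
      rw [map_add, map_smul, map_smul]; simp
    rw [h2, h3]
    have h4 : (e θ)⁻¹ = Real.cos θ - Real.sin θ * Complex.I := by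
      rw [inv_eq_iff_eq_inv, eq_comm, inv_eq_of_mul_eq_one_left]
      simp only [he]
      have : (Real.cos θ : ℂ) ^ 2 + (Real.sin θ : ℂ) ^ 2 = 1 := by
        exact_mod_cast Real.cos_sq_add_sin_sq θ
      linear_combination this - (Real.sin θ : ℂ) ^ 2 * Complex.I_mul_I
    rw [mul_inv, h4, Complex.real_smul]
    field_simp
    linear_combination (- Real.sin θ * fderiv ℝ f (r * e θ) Complex.I : ℂ) * Complex.I_mul_I
  rw [hcong, integral_add iA (iB.const_mul _), integral_const_mul]
  have hAi : ∫ p in Set.Ioi (0 : ℝ) ×ˢ Set.Ioo (-π) π, A p = -(2 * π) * f 0 := by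
    rw [Measure.volume_eq_prod, ← setIntegral_prod_swap, setIntegral_prod]
    · have : ∀ θ : ℝ, ∫ r in Set.Ioi (0 : ℝ), A (r, θ) = - f 0 := by
        intro θ
        have hd : ∀ r : ℝ, HasDerivAt (fun r : ℝ => f (r * e θ)) (A (r, θ)) r := by
          intro r
          have h1 : HasDerivAt (fun r : ℝ => (r : ℂ) * e θ) (e θ) r := by
            simpa using (Complex.ofRealCLM.hasDerivAt (x := r)).mul_const (e θ)
          exact (smooth_diff hf.1 _).hasFDerivAt.comp_hasDerivAt r h1
        have hcs : HasCompactSupport (fun r : ℝ => f (r * e θ)) := by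
          obtain ⟨R', hR'⟩ := hf.2.isCompact.isBounded.subset_closedBall 0
          refine HasCompactSupport.of_support_subset_isCompact (isCompact_closedBall (0 : ℝ) R') ?_
          intro r hr
          have := hR' (subset_tsupport _ hr)
          simpa [ne] using this
        have hc0 : ContDiff ℝ 1 (fun r : ℝ => (r : ℂ) * e θ) :=
          Complex.ofRealCLM.contDiff.mul contDiff_const
        have hc1 : ContDiff ℝ 1 (fun r : ℝ => f (r * e θ)) :=
          (hf.1.of_le (by exact_mod_cast le_top)).comp hc0
        have := HasCompactSupport.integral_Ioi_deriv_eq (f := fun r : ℝ => f (r * e θ))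
          hc1 hcs 0
        rw [← show (fun r => deriv (fun r : ℝ => f (r * e θ)) r) = fun r => A (r, θ) from
          funext fun r => (hd r).deriv]
        simpa using this
      simp only [Prod.swap_prod_mk, this]
      rw [setIntegral_const]
      rw [Real.volume_real_Ioo_of_le (by linarith [Real.pi_pos]), Complex.real_smul]
      push_cast
      ring
    · exact iA.swap
  have hBi : ∫ p in Set.Ioi (0 : ℝ) ×ˢ Set.Ioo (-π) π, B p = 0 := by
    rw [Measure.volume_eq_prod, setIntegral_prod _ iB]
    rw [← integral_zero ℝ ℂ (μ := volume.restrict (Set.Ioi 0))]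
    refine setIntegral_congr_fun measurableSet_Ioi fun r hr => ?_
    have hr' : r ≠ 0 := ne_of_gt hr
    have hd : ∀ θ : ℝ, HasDerivAt (fun θ : ℝ => f (r * e θ)) (r • B (r, θ)) θ := by
      intro θ
      have h0 : HasDerivAt e (Complex.I * e θ) θ := by
        have h1 := (Real.hasDerivAt_cos θ).ofReal_comp.add
          ((Real.hasDerivAt_sin θ).ofReal_comp.mul_const Complex.I)
        have h3 : Complex.I * e θ = ((-Real.sin θ : ℝ) : ℂ) + (Real.cos θ : ℂ) * Complex.I := by
          simp only [he, Complex.ofReal_neg]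
          linear_combination (Real.sin θ : ℂ) * Complex.I_mul_I
        rw [h3]
        exact h1
      have h2 := (smooth_diff hf.1 (r * e θ)).hasFDerivAt.comp_hasDerivAt θ (h0.const_mul (r : ℂ))
      have h3 : r • B (r, θ) = fderiv ℝ f (r * e θ) (r * (Complex.I * e θ)) := by
        change r • fderiv ℝ f (r * e θ) (Complex.I * e θ) = _
        rw [← map_smul, Complex.real_smul]
      rw [h3]
      exact h2
    have h := intervalIntegral.integral_eq_sub_of_hasDerivAt (a := -π) (b := π)
      (fun θ _ => hd θ) (by
        refine Continuous.intervalIntegrable ?_ _ _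
        fun_prop)
    simp only [he, Real.cos_neg, Real.sin_neg, Real.sin_pi, neg_zero, sub_self] at h
    rw [intervalIntegral.integral_smul, smul_eq_zero] at h
    have h := h.resolve_left hr'
    rw [intervalIntegral.integral_of_le (by linarith [Real.pi_pos]),
      integral_Ioc_eq_integral_Ioo] at h
    exact h
  rw [hAi, hBi]; simp

/-- generic convolution -/
noncomputable def cv {A : Type*} [NormedRing A] [NormedAlgebra ℝ A] (κ f : ℂ → A) : ℂ → A :=
  convolution κ f (ContinuousLinearMap.mul ℝ A) volume

section
variable {A : Type*} [NormedRing A] [NormedAlgebra ℝ A] {κ f : ℂ → A}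

lemma cv_apply (z : ℂ) : cv κ f z = ∫ t, κ t * f (z - t) := rfl

lemma cv_smooth (hκ : LocallyIntegrable κ) (hf : Test f) : ContDiff ℝ (⊤ : ℕ∞) (cv κ f) :=
  hf.2.contDiff_convolution_right _ hκ hf.1

lemma cv_fderiv (hκ : LocallyIntegrable κ) (hf : Test f) (z e : ℂ) :
    fderiv ℝ (cv κ f) z e = cv κ (fun w => fderiv ℝ f w e) z := by
  have h := (hf.2.hasFDerivAt_convolution_right (ContinuousLinearMap.mul ℝ A) hκ
    (hf.1.of_le (by simp)) z).fderiv
  have h2 := convolution_precompR_apply (ContinuousLinearMap.mul ℝ A) hκ (hf.2.fderiv (𝕜 := ℝ))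
    (hf.1.continuous_fderiv (by simp)) z e
  rw [cv, h, h2, cv]
end

lemma Test.reflect {F : Type*} [NormedAddCommGroup F] [NormedSpace ℝ F] {f : ℂ → F}
    (hf : Test f) (z : ℂ) : Test (fun t => f (z - t)) :=
  ⟨hf.1.comp (by fun_prop), hf.2.comp_homeomorph (Homeomorph.subLeft z)⟩

lemma fderiv_reflect {F : Type*} [NormedAddCommGroup F] [NormedSpace ℝ F] {f : ℂ → F}
    (hf : ContDiff ℝ (⊤ : ℕ∞) f) (z t e : ℂ) :
    fderiv ℝ (fun t => f (z - t)) t e = - fderiv ℝ f (z - t) e := by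
  have h := ((smooth_diff hf (z - t)).hasFDerivAt.comp t ((hasFDerivAt_id t).const_sub z)).fderiv
  have h2 : (fun t => f (z - t)) = f ∘ HSub.hSub z := rfl
  rw [h2, h]; simp

lemma cauchy_db {f : ℂ → ℂ} (hf : Test f) (z : ℂ) :
    cv (fun z => z⁻¹) (db f) z = (2 * π) * f z := by
  have h := pompeiu0 (hf.reflect z)
  have : ∀ t, db (fun t => f (z - t)) t = - db f (z - t) := by
    intro t; simp only [db, fderiv_reflect hf.1]; ring
  simp only [this, mul_neg, integral_neg, sub_zero] at h
  rw [cv_apply]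
  linear_combination -h

lemma db_cauchy {f : ℂ → ℂ} (hf : Test f) (z : ℂ) :
    db (cv (fun z => z⁻¹) f) z = (2 * π) * f z := by
  rw [← cauchy_db hf, db, cv_fderiv locInt_cinv hf, cv_fderiv locInt_cinv hf]
  simp only [cv_apply, db, mul_add]
  rw [integral_add, ← integral_const_mul]
  · congr 2; ext; ring
  · exact LI_mul_test locInt_cinv ((hf.fderiv 1).reflect z)
  · exact LI_mul_test locInt_cinv (Test.mul_left contDiff_const ((hf.fderiv Complex.I).reflect z))

end DiracPlane
namespace DiracPlane

/-- real inner product on the plane -/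
def ip (t e : ℂ) : ℝ := t.re * e.re + t.im * e.im

lemma ip_le (t e : ℂ) : |ip t e| ≤ ‖t‖ * ‖e‖ := by
  have h : ip t e = (t * (starRingEnd ℂ) e).re := by simp [ip]
  rw [h]
  refine (Complex.abs_re_le_norm _).trans ?_
  simp

lemma reg_deriv (δ : ℝ) (hδ : 0 < δ) (t e : ℂ) :
    DifferentiableAt ℝ (fun t : ℂ => (1 / 2 : ℝ) * Real.log (Complex.normSq t + δ)) t ∧
    fderiv ℝ (fun t : ℂ => (1 / 2 : ℝ) * Real.log (Complex.normSq t + δ)) t e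
      = ip t e / (Complex.normSq t + δ) := by
  have h0 : (fun t : ℂ => (1 / 2 : ℝ) * Real.log (Complex.normSq t + δ))
      = fun t : ℂ => (1 / 2 : ℝ) * Real.log (t.re * t.re + t.im * t.im + δ) := by
    ext t; simp [Complex.normSq_apply]
  have hpos : 0 < t.re * t.re + t.im * t.im + δ := by
    nlinarith [mul_self_nonneg t.re, mul_self_nonneg t.im]
  have hre : HasFDerivAt (fun t : ℂ => t.re) Complex.reCLM t := Complex.reCLM.hasFDerivAt
  have him : HasFDerivAt (fun t : ℂ => t.im) Complex.imCLM t := Complex.imCLM.hasFDerivAt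
  have h := ((((hre.mul hre).add (him.mul him)).add_const δ).log hpos.ne').const_mul (1 / 2 : ℝ)
  rw [h0]
  refine ⟨h.differentiableAt, ?_⟩
  erw [h.fderiv]
  simp [ip, Complex.normSq_apply]
  field_simp
  ring

lemma log_ibp {F : ℂ → ℝ} (hF : Test F) (e : ℂ) :
    ∫ t, Real.log ‖t‖ * fderiv ℝ F t e = - ∫ t, ip t e / Complex.normSq t * F t := by
  set δ : ℕ → ℝ := fun n => 1 / ((n : ℝ) + 1) with hδ
  have δpos : ∀ n, 0 < δ n := fun n => by simp only [hδ]; positivity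
  have δle : ∀ n, δ n ≤ 1 := fun n => by
    simp only [hδ]; rw [div_le_one (by positivity)]; linarith [n.cast_nonneg (α := ℝ)]
  have δlim : Filter.Tendsto δ Filter.atTop (nhds 0) := tendsto_one_div_add_atTop_nhds_zero_nat
  have cip : Continuous (fun t => ip t e) := by unfold ip; fun_prop
  have cns : Continuous (fun t => Complex.normSq t) := Complex.continuous_normSq
  have cL : ∀ n, Continuous (fun t : ℂ => (1 / 2 : ℝ) * Real.log (Complex.normSq t + δ n)) := by
    intro n
    refine continuous_const.mul (Continuous.log (by fun_prop) fun t => ?_)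
    have := Complex.normSq_nonneg t; have := δpos n; positivity
  have cD : ∀ n, Continuous (fun t : ℂ => ip t e / (Complex.normSq t + δ n)) := by
    intro n
    refine cip.div (by fun_prop) fun t => ?_
    have := Complex.normSq_nonneg t; have := δpos n; positivity
  have ibp : ∀ n, ∫ t, (1 / 2 : ℝ) * Real.log (Complex.normSq t + δ n) * fderiv ℝ F t e
      = - ∫ t, ip t e / (Complex.normSq t + δ n) * F t := by
    intro n
    have := integral_mul_fderiv_eq_neg_fderiv_mul_of_integrable (μ := (volume : Measure ℂ))
      (f := fun t : ℂ => (1 / 2 : ℝ) * Real.log (Complex.normSq t + δ n)) (g := F) (v := e)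
      (by
        simp only [(reg_deriv (δ n) (δpos n) _ e).2]
        exact ((cD n).mul hF.1.continuous).integrable_of_hasCompactSupport hF.2.mul_left)
      (((cL n).mul (hF.fderiv e).1.continuous).integrable_of_hasCompactSupport
        (hF.fderiv e).2.mul_left)
      (((cL n).mul hF.1.continuous).integrable_of_hasCompactSupport hF.2.mul_left)
      (fun x _ => (reg_deriv (δ n) (δpos n) x e).1) (fun x _ => smooth_diff hF.1 x)
    rw [this]
    simp only [(reg_deriv (δ n) (δpos n) _ e).2]
  have ae0 : ∀ᵐ t : ℂ, t ≠ 0 := by simp [ae_iff]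
  have l1 : Filter.Tendsto (fun n => ∫ t, (1 / 2 : ℝ) * Real.log (Complex.normSq t + δ n)
      * fderiv ℝ F t e) Filter.atTop (nhds (∫ t, Real.log ‖t‖ * fderiv ℝ F t e)) := by
    refine tendsto_integral_of_dominated_convergence
      (fun t => (‖t‖⁻¹ + (‖t‖ + ‖t‖ ^ 2)) * ‖fderiv ℝ F t e‖)
      (fun n => ((cL n).mul (hF.fderiv e).1.continuous).aestronglyMeasurable) ?_ ?_ ?_
    · have h := LI_mul_test (κ := fun t => ‖t‖⁻¹ + (‖t‖ + ‖t‖ ^ 2)) (locInt_inv.add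
        (Continuous.locallyIntegrable (by fun_prop))) (hF.fderiv e)
      refine h.norm.congr (.of_forall fun t => ?_)
      simp only [norm_mul]
      congr 1
      rw [Real.norm_eq_abs, abs_of_nonneg (by positivity)]
    · intro n
      filter_upwards [ae0] with t ht
      rw [norm_mul]
      refine mul_le_mul_of_nonneg_right ?_ (norm_nonneg _)
      have hr : 0 < ‖t‖ := norm_pos_iff.2 ht
      have h1 : Real.log ‖t‖ = 1 / 2 * Real.log (Complex.normSq t) := by
        rw [Complex.normSq_eq_norm_sq, Real.log_pow]; push_cast; ring
      have hn : 0 < Complex.normSq t := Complex.normSq_pos.2 ht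
      have h2 : Real.log (Complex.normSq t) ≤ Real.log (Complex.normSq t + δ n) :=
        Real.log_le_log hn (by linarith [δpos n])
      have h3 : Real.log (Complex.normSq t + δ n) ≤ Complex.normSq t := by
        have := Real.log_le_sub_one_of_pos (x := Complex.normSq t + δ n) (by linarith [δpos n])
        linarith [δle n]
      have h4 := abs_le.1 (abs_log_le ‖t‖ hr.le)
      have h5 : 0 < ‖t‖⁻¹ := inv_pos.2 hr
      rw [Complex.normSq_eq_norm_sq] at *
      rw [Real.norm_eq_abs, abs_le]
      constructor <;> nlinarith
    · filter_upwards [ae0] with t ht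
      have hn : 0 < Complex.normSq t := Complex.normSq_pos.2 ht
      have h1 : Real.log ‖t‖ = 1 / 2 * Real.log (Complex.normSq t + 0) := by
        rw [Complex.normSq_eq_norm_sq, add_zero, Real.log_pow]; push_cast; ring
      rw [h1]
      refine Filter.Tendsto.mul_const _ (Filter.Tendsto.const_mul _ ?_)
      exact (Real.continuousAt_log (by linarith)).tendsto.comp (δlim.const_add _)
  have l2 : Filter.Tendsto (fun n => ∫ t, ip t e / (Complex.normSq t + δ n) * F t)
      Filter.atTop (nhds (∫ t, ip t e / Complex.normSq t * F t)) := by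
    refine tendsto_integral_of_dominated_convergence
      (fun t => (‖t‖⁻¹ * ‖F t‖) * ‖e‖)
      (fun n => ((cD n).mul hF.1.continuous).aestronglyMeasurable) ?_ ?_ ?_
    · have h := LI_mul_test locInt_inv hF
      refine (h.norm.congr (.of_forall fun t => ?_)).mul_const _
      simp only [norm_mul]
      congr 1
      simp
    · intro n
      filter_upwards [ae0] with t ht
      have hr : 0 < ‖t‖ := norm_pos_iff.2 ht
      rw [norm_mul, mul_right_comm]
      refine mul_le_mul_of_nonneg_right ?_ (norm_nonneg _)
      have hn : 0 < Complex.normSq t := Complex.normSq_pos.2 ht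
      rw [Real.norm_eq_abs, abs_div, abs_of_pos (by linarith [δpos n] : 0 < Complex.normSq t + δ n),
        div_le_iff₀ (by linarith [δpos n])]
      have h1 : ‖t‖⁻¹ * ‖e‖ * (Complex.normSq t) = ‖t‖ * ‖e‖ := by
        rw [Complex.normSq_eq_norm_sq]; field_simp
      have h2 : 0 ≤ ‖t‖⁻¹ * ‖e‖ * δ n := by have := δpos n; positivity
      linarith [ip_le t e]
    · filter_upwards [ae0] with t ht
      have hn : 0 < Complex.normSq t := Complex.normSq_pos.2 ht
      refine Filter.Tendsto.mul_const _ (Filter.Tendsto.div tendsto_const_nhds ?_ hn.ne')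
      simpa using δlim.const_add (Complex.normSq t)
  simp_rw [ibp] at l1
  exact tendsto_nhds_unique l1 l2.neg

lemma Test.ofReal {f : ℂ → ℝ} (hf : Test f) : Test (fun z => (f z : ℂ)) :=
  ⟨smooth_ofReal hf.1, hf.2.comp_left (g := fun x : ℝ => (x : ℂ)) (by simp)⟩

lemma green0 {h : ℂ → ℝ} (hh : Test h) : ∫ t, Real.log ‖t‖ * lap h t = 2 * π * h 0 := by
  have h1 := log_ibp (hh.fderiv 1) 1
  have h2 := log_ibp (hh.fderiv Complex.I) Complex.I
  have iip : ∀ e : ℂ, LocallyIntegrable (fun t : ℂ => ip t e / Complex.normSq t) := by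
    intro e
    refine (locInt_inv.smul ‖e‖).mono ?_ (.of_forall fun t => ?_)
    · have : Measurable (fun t => ip t e) := by unfold ip; fun_prop
      exact (this.div Complex.continuous_normSq.measurable).aestronglyMeasurable
    · rcases eq_or_ne t 0 with rfl | ht
      · simp
      have hr : 0 < ‖t‖ := norm_pos_iff.2 ht
      simp only [Pi.smul_apply, smul_eq_mul, norm_mul, norm_inv, norm_norm]
      rw [norm_div, Real.norm_eq_abs, Complex.normSq_eq_norm_sq, norm_pow, norm_norm,
        div_le_iff₀ (by positivity)]
      have := ip_le t e
      field_simp; linarith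
  have hp := pompeiu0 hh.ofReal
  have hl : ∫ t, Real.log ‖t‖ * lap h t = - ∫ t, (ip t 1 / Complex.normSq t * fderiv ℝ h t 1
      + ip t Complex.I / Complex.normSq t * fderiv ℝ h t Complex.I) := by
    rw [integral_add (LI_mul_test (iip 1) (hh.fderiv 1))
      (LI_mul_test (iip Complex.I) (hh.fderiv Complex.I)), neg_add, ← h1, ← h2, ← integral_add
      (LI_mul_test locInt_log ((hh.fderiv 1).fderiv 1))
      (LI_mul_test locInt_log ((hh.fderiv Complex.I).fderiv Complex.I))]
    simp only [lap, mul_add]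
  have hre := congrArg Complex.re hp
  have hi : Integrable (fun z : ℂ => z⁻¹ * db (fun z => (h z : ℂ)) z) :=
    LI_mul_test locInt_cinv hh.ofReal.db
  have e2 := integral_re hi
  simp only [RCLike.re_eq_complex_re] at e2
  rw [← e2] at hre
  have e1 : ∀ t : ℂ, (t⁻¹ * db (fun z => (h z : ℂ)) t).re = ip t 1 / Complex.normSq t * fderiv ℝ h t 1
      + ip t Complex.I / Complex.normSq t * fderiv ℝ h t Complex.I := by
    intro t
    simp only [db, fderiv_ofReal hh.1]
    simp [ip, Complex.inv_re, Complex.inv_im]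
    ring
  simp_rw [e1] at hre
  rw [hl, hre]
  simp

lemma lap_log {h : ℂ → ℝ} (hh : Test h) (z : ℂ) :
    lap (cv (fun t => Real.log ‖t‖) h) z = 2 * π * h z := by
  have hg := green0 (hh.reflect z)
  have e1 : ∀ e w, fderiv ℝ (cv (fun t => Real.log ‖t‖) h) w e = _ :=
    fun e w => cv_fderiv locInt_log hh w e
  simp only [lap, e1]
  erw [cv_fderiv locInt_log (hh.fderiv 1), cv_fderiv locInt_log (hh.fderiv Complex.I)]
  rw [sub_zero] at hg
  rw [← hg, cv_apply, cv_apply, ← integral_add]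
  · congr 1
    ext t
    have e2 : ∀ e, fderiv ℝ (fun w => fderiv ℝ (fun t => h (z - t)) w e) t e
        = fderiv ℝ (fun w => fderiv ℝ h w e) (z - t) e := by
      intro e
      simp only [fderiv_reflect hh.1]
      rw [fderiv_fun_neg]
      have := fderiv_reflect (hh.fderiv e).1 z t e
      simp [this]
    rw [lap, e2, e2]; ring
  · exact LI_mul_test locInt_log (((hh.fderiv 1).fderiv 1).reflect z)
  · exact LI_mul_test locInt_log (((hh.fderiv Complex.I).fderiv Complex.I).reflect z)

end DiracPlane
namespace DiracPlane

lemma Test.radius {F : Type*} [NormedAddCommGroup F] [NormedSpace ℝ F] {f : ℂ → F}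
    (hf : Test f) : ∃ R, ∀ z, f z ≠ 0 → ‖z‖ ≤ R := by
  obtain ⟨R, hR⟩ := hf.2.isCompact.isBounded.subset_closedBall 0
  exact ⟨R, fun z hz => by simpa using hR (subset_tsupport _ hz)⟩

lemma decay {f : ℂ → ℂ} (hf : Test f) {R : ℝ} (hR : ∀ z, f z ≠ 0 → ‖z‖ ≤ R) {z : ℂ}
    (hz : 2 * R ≤ ‖z‖) (hz0 : 0 < ‖z‖) :
    ‖cv (fun t => t⁻¹) f z‖ ≤ 2 / ‖z‖ * ∫ w, ‖f w‖ := by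
  rw [cv_apply, ← integral_sub_left_eq_self (fun w => ‖f w‖) volume z, ← integral_const_mul]
  refine norm_integral_le_of_norm_le ((hf.reflect z).integrable.norm.const_mul _)
    (.of_forall fun t => ?_)
  rw [norm_mul]
  by_cases h : f (z - t) = 0
  · simp [h]
  refine mul_le_mul_of_nonneg_right ?_ (norm_nonneg _)
  have h1 := hR _ h
  have h2 : ‖z‖ ≤ ‖z - t‖ + ‖t‖ := by simpa using norm_add_le (z - t) t
  rw [norm_inv, inv_le_comm₀ (by linarith) (by positivity), inv_div]
  linarith

lemma log_growth {h : ℂ → ℝ} (hh : Test h) (h0 : ∀ z, 0 ≤ h z) {R : ℝ}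
    (hR : ∀ z, h z ≠ 0 → ‖z‖ ≤ R) (hR1 : 1 ≤ R) (z : ℂ) :
    cv (fun t => Real.log ‖t‖) h z ≤ Real.log (‖z‖ + R) * ∫ w, h w := by
  rw [cv_apply, ← integral_sub_left_eq_self h volume z, ← integral_const_mul]
  refine integral_mono (LI_mul_test locInt_log (hh.reflect z))
    ((hh.reflect z).integrable.const_mul _) fun t => ?_
  by_cases h' : h (z - t) = 0
  · simp [h']
  refine mul_le_mul_of_nonneg_right ?_ (h0 _)
  have h1 := hR _ h'
  have h2 : ‖t‖ ≤ ‖z‖ + ‖z - t‖ := by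
    simpa using norm_sub_le z (z - t)
  rcases eq_or_ne t 0 with rfl | ht
  · simpa using Real.log_nonneg (by linarith [norm_nonneg z])
  · exact Real.log_le_log (norm_pos_iff.2 ht) (by linarith)

lemma exists_cutoff : ∃ η : ℂ → ℂ, Test η ∧ (∀ z, ‖z‖ ≤ 1 → η z = 1) ∧
    (∀ z, 2 < ‖z‖ → db η z = 0) ∧ (∀ z, ‖z‖ < 1 → db η z = 0) := by
  let b : ContDiffBump (0 : ℂ) := ⟨1, 2, by norm_num, by norm_num⟩
  have tb : Test (fun z => b z) := ⟨b.contDiff, b.hasCompactSupport⟩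
  have hz : ∀ z, fderiv ℝ (fun z => ((b z : ℝ) : ℂ)) z = 0 → db (fun z => ((b z : ℝ) : ℂ)) z = 0 :=
    fun z h => by simp [db, h]
  refine ⟨fun z => (b z : ℂ), tb.ofReal, fun z hz => ?_, fun z h => hz z ?_, fun z h => hz z ?_⟩
  · have : b z = 1 := b.one_of_mem_closedBall (by simpa [b] using hz)
    simp [this]
  · have : (fun z => ((b z : ℝ) : ℂ)) =ᶠ[nhds z] fun _ => 0 := by
      have ho : IsOpen {z : ℂ | 2 < ‖z‖} := isOpen_lt continuous_const continuous_norm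
      filter_upwards [ho.mem_nhds h] with w hw
      have : b w = 0 := b.zero_of_le_dist (by simpa [b] using le_of_lt hw)
      simp [this]
    rw [this.fderiv_eq]; simp
  · have : (fun z => ((b z : ℝ) : ℂ)) =ᶠ[nhds z] fun _ => 1 := by
      have ho : IsOpen {z : ℂ | ‖z‖ < 1} := isOpen_lt continuous_norm continuous_const
      filter_upwards [ho.mem_nhds h] with w hw
      have : b w = 1 := b.one_of_mem_closedBall (by simpa [b] using le_of_lt hw)
      simp [this]
    rw [this.fderiv_eq]; simp

lemma db_mul {f g : ℂ → ℂ} (hf : ContDiff ℝ (⊤ : ℕ∞) f) (hg : ContDiff ℝ (⊤ : ℕ∞) g) (z : ℂ) :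
    db (fun z => f z * g z) z = f z * db g z + g z * db f z := by
  simp only [db]
  rw [fderiv_fun_mul (smooth_diff hf z) (smooth_diff hg z)]
  simp; ring

lemma db_scale {f : ℂ → ℂ} (hf : ContDiff ℝ (⊤ : ℕ∞) f) (s : ℝ) (z : ℂ) :
    db (fun z => f (s • z)) z = s * db f (s • z) := by
  have h := ((smooth_diff hf (s • z)).hasFDerivAt.comp z ((hasFDerivAt_id z).const_smul s)).fderiv
  have h2 : ∀ e, fderiv ℝ (fun z => f (s • z)) z e = s * fderiv ℝ f (s • z) e := by
    intro e
    have h3 : (fun z => f (s • z)) = f ∘ HSMul.hSMul s := rfl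
    rw [h3, h]; simp
  simp only [db, h2]; ring

lemma Test.scale {f : ℂ → ℂ} (hf : Test f) {s : ℝ} (hs : s ≠ 0) : Test (fun z => f (s • z)) :=
  ⟨hf.1.comp (contDiff_const_smul s), hf.2.comp_homeomorph (Homeomorph.smulOfNeZero s hs)⟩

/-- the weight -/
noncomputable def wt (c : ℝ) (h : ℂ → ℝ) (z : ℂ) : ℝ :=
  c / (2 * π) * cv (fun t => Real.log ‖t‖) h z

lemma wt_smooth (c : ℝ) {h : ℂ → ℝ} (hh : Test h) : ContDiff ℝ (⊤ : ℕ∞) (wt c h) :=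
  contDiff_const.mul (cv_smooth locInt_log hh)

lemma wt_lap (c : ℝ) {h : ℂ → ℝ} (hh : Test h) (z : ℂ) : lap (wt c h) z = c * h z := by
  have h1 := lap_log hh z
  have s := cv_smooth locInt_log hh
  have e1 : ∀ e w, fderiv ℝ (wt c h) w e
      = c / (2 * π) * fderiv ℝ (cv (fun t => Real.log ‖t‖) h) w e := by
    intro e w
    unfold wt
    rw [fderiv_const_mul (smooth_diff s w)]; simp
  simp only [lap, e1] at *
  rw [fderiv_const_mul (smooth_diff (smooth_fderiv s _) z),
    fderiv_const_mul (smooth_diff (smooth_fderiv s _) z)]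
  simp only [smul_apply, smul_eq_mul]
  rw [← mul_add, h1]
  field_simp

/-- Cauchy transform -/
noncomputable def Cau (f : ℂ → ℂ) (z : ℂ) : ℂ := (2 * (π : ℂ))⁻¹ * cv (fun t => t⁻¹) f z

lemma Cau_smooth {f : ℂ → ℂ} (hf : Test f) : ContDiff ℝ (⊤ : ℕ∞) (Cau f) :=
  contDiff_const.mul (cv_smooth locInt_cinv hf)

lemma two_pi_ne : (2 * (π : ℂ)) ≠ 0 := by
  have := Real.pi_ne_zero
  norm_num

lemma db_Cau {f : ℂ → ℂ} (hf : Test f) (z : ℂ) : db (Cau f) z = f z := by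
  have h := db_mul (f := fun _ => (2 * (π : ℂ))⁻¹) contDiff_const (cv_smooth locInt_cinv hf) z
  have h2 : Cau f = fun z => (2 * (π : ℂ))⁻¹ * cv (fun t => t⁻¹) f z := rfl
  rw [h2, h, db_cauchy hf]
  have := two_pi_ne
  simp [db]
  field_simp

lemma Cau_db {f : ℂ → ℂ} (hf : Test f) (z : ℂ) : Cau (db f) z = f z := by
  rw [Cau, cauchy_db hf, inv_mul_cancel_left₀ two_pi_ne]

lemma sq_int {w : ℂ → ℝ} (hw : Continuous w) {f : ℂ → ℂ} (hf : Continuous f)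
    (hc : HasCompactSupport f) : Integrable (fun z => w z * ‖f z‖ ^ 2) := by
  refine Continuous.integrable_of_hasCompactSupport (by fun_prop) ?_
  exact (hc.comp_left (g := fun x : ℂ => ‖x‖ ^ 2) (by simp)).mul_left

lemma hormander {h : ℂ → ℝ} (hh : Test h) (h0 : ∀ z, 0 ≤ h z) {c : ℝ} (hc : 0 < c)
    (hcM : c * ∫ z, h z < 4 * π) {f : ℂ → ℂ} (hf : Test f) :
    c * ∫ z, Real.exp (wt c h z) * h z * ‖Cau f z‖ ^ 2
      ≤ ∫ z, Real.exp (wt c h z) * ‖f z‖ ^ 2 := by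
  obtain ⟨R1, hR1⟩ := hh.radius
  obtain ⟨R2, hR2⟩ := hf.radius
  obtain ⟨η, tη, η1, ηo, ηi⟩ := exists_cutoff
  set R0 := max 1 (max R1 R2) with hR0
  have hR0h : ∀ z, h z ≠ 0 → ‖z‖ ≤ R0 := fun z hz =>
    (hR1 z hz).trans ((le_max_left _ _).trans (le_max_right _ _))
  have hR0f : ∀ z, f z ≠ 0 → ‖z‖ ≤ R0 := fun z hz =>
    (hR2 z hz).trans ((le_max_right _ _).trans (le_max_right _ _))
  have hR01 : 1 ≤ R0 := le_max_left _ _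
  obtain ⟨K, hK⟩ := tη.db.1.continuous.bounded_above_of_compact_support tη.db.2
  set N := ∫ w, ‖f w‖ with hN
  have hN0 : 0 ≤ N := integral_nonneg fun _ => norm_nonneg _
  have hM0 : 0 ≤ ∫ z, h z := integral_nonneg h0
  set α := c / (2 * π) * ∫ z, h z with hα
  have hα0 : 0 ≤ α := by have := Real.pi_pos; positivity
  have hα2 : α < 2 := by
    rw [hα, div_mul_eq_mul_div, div_lt_iff₀ (by positivity)]; linarith
  set ϕ := wt c h with hϕ
  have sϕ : ContDiff ℝ (⊤ : ℕ∞) ϕ := wt_smooth c hh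
  have cϕ := sϕ.continuous
  have ch := hh.1.continuous
  have cf := hf.1.continuous
  have cC := (Cau_smooth hf).continuous
  have growth : ∀ z, Real.exp (ϕ z) ≤ (‖z‖ + R0) ^ α := by
    intro z
    have h1 := log_growth hh h0 hR0h hR01 z
    have h2 : 0 < ‖z‖ + R0 := by linarith [norm_nonneg z]
    rw [Real.rpow_def_of_pos h2, Real.exp_le_exp, hϕ, wt, hα]
    calc _ ≤ c / (2 * π) * (Real.log (‖z‖ + R0) * ∫ w, h w) := by gcongr
      _ = _ := by ring
  have dec : ∀ z, 2 * R0 ≤ ‖z‖ → ‖Cau f z‖ ≤ N / ‖z‖ := by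
    intro z hz
    have hz0 : 0 < ‖z‖ := by linarith
    have h1 := decay hf hR0f hz hz0
    rw [Cau, norm_mul]
    have h2 : ‖(2 * (π : ℂ))⁻¹‖ = (2 * π)⁻¹ := by
      rw [norm_inv, norm_mul]; simp [abs_of_pos Real.pi_pos]
    rw [h2]
    calc _ ≤ (2 * π)⁻¹ * (2 / ‖z‖ * N) := by gcongr
      _ = π⁻¹ * (N / ‖z‖) := by field_simp
      _ ≤ 1 * (N / ‖z‖) := by
        gcongr
        exact inv_le_one_of_one_le₀ (by linarith [Real.pi_gt_three])
      _ = _ := one_mul _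
  have main : ∀ R, 2 * R0 < R → c * ∫ z, Real.exp (ϕ z) * h z * ‖Cau f z‖ ^ 2
      ≤ (∫ z, Real.exp (ϕ z) * ‖f z‖ ^ 2)
        + (3 ^ α * N ^ 2 * K ^ 2 * (4 * π)) * R ^ (-(2 - α)) := by
    intro R hR
    have hRpos : 0 < R := by linarith
    set χ : ℂ → ℂ := fun z => η (R⁻¹ • z) with hχ
    have tχ : Test χ := tη.scale (inv_ne_zero hRpos.ne')
    have dχ : ∀ z, db χ z = R⁻¹ * db η (R⁻¹ • z) := fun z => by
      have := db_scale tη.1 R⁻¹ z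
      rw [hχ, this]
    have nrm : ∀ z : ℂ, ‖R⁻¹ • z‖ = ‖z‖ / R := fun z => by
      rw [norm_smul, norm_inv, Real.norm_eq_abs, abs_of_pos hRpos]; field_simp
    have tv : Test (fun z => Cau f z * χ z) := Test.mul_left (Cau_smooth hf) tχ
    have B := basic_ineq tv sϕ
    have dv : ∀ z, db (fun z => Cau f z * χ z) z = Cau f z * db χ z + χ z * f z := fun z => by
      rw [db_mul (Cau_smooth hf) tχ.1, db_Cau hf]
    have χ1 : ∀ z, ‖z‖ ≤ R → χ z = 1 := fun z hz => η1 _ (by rw [nrm]; exact (div_le_one hRpos).2 hz)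
    have e1 : ∀ z, Real.exp (ϕ z) * lap ϕ z * ‖Cau f z * χ z‖ ^ 2
        = c * (Real.exp (ϕ z) * h z * ‖Cau f z‖ ^ 2) := by
      intro z
      rw [hϕ, wt_lap c hh]
      by_cases hz : h z = 0
      · simp [hz]
      · rw [χ1 z (by linarith [hR0h z hz])]; simp; ring
    have e2 : ∀ z, Real.exp (ϕ z) * ‖db (fun z => Cau f z * χ z) z‖ ^ 2
        = Real.exp (ϕ z) * ‖f z‖ ^ 2 + Real.exp (ϕ z) * ‖Cau f z * db χ z‖ ^ 2 := by
      intro z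
      rw [dv]
      by_cases hz : f z = 0
      · simp [hz]
      · have h1 : ‖z‖ < R := by linarith [hR0f z hz]
        rw [χ1 z h1.le, dχ, ηi _ (by rw [nrm]; exact (div_lt_one hRpos).2 h1)]
        simp
    simp only [e1, e2] at B
    have tCd : Test (fun z => Cau f z * db χ z) := Test.mul_left (Cau_smooth hf) tχ.db
    rw [integral_const_mul, integral_add (sq_int (by fun_prop) cf hf.2)
      (sq_int (by fun_prop) tCd.1.continuous tCd.2)] at B
    refine B.trans (add_le_add le_rfl ?_)
    set C0 := (3 * R) ^ α * ((N / R) * (K / R)) ^ 2 with hC0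
    have b1 : ∀ z, Real.exp (ϕ z) * ‖Cau f z * db χ z‖ ^ 2
        ≤ (Metric.closedBall (0 : ℂ) (2 * R)).indicator (fun _ => C0) z := by
      intro z
      by_cases hz1 : ‖z‖ < R
      · rw [dχ, ηi _ (by rw [nrm]; exact (div_lt_one hRpos).2 hz1)]
        simp only [mul_zero, norm_zero]
        refine le_trans (by simp) (Set.indicator_nonneg (fun _ _ => ?_) z)
        positivity
      by_cases hz2 : 2 * R < ‖z‖
      · rw [dχ, ηo _ (by rw [nrm]; rw [lt_div_iff₀ hRpos]; exact hz2)]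
        simp only [mul_zero, norm_zero]
        refine le_trans (by simp) (Set.indicator_nonneg (fun _ _ => ?_) z)
        positivity
      push Not at hz1 hz2
      rw [Set.indicator_of_mem (by simpa using hz2)]
      have g1 : Real.exp (ϕ z) ≤ (3 * R) ^ α := (growth z).trans
        (Real.rpow_le_rpow (by linarith) (by linarith) hα0)
      have g2 : ‖Cau f z‖ ≤ N / R := (dec z (by linarith)).trans (by gcongr)
      have g3 : ‖db χ z‖ ≤ K / R := by
        rw [dχ, norm_mul, Complex.norm_real, norm_inv, Real.norm_eq_abs, abs_of_pos hRpos,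
          div_eq_inv_mul]
        gcongr
        exact hK _
      rw [norm_mul, hC0]
      gcongr
    refine (integral_mono_of_nonneg (.of_forall fun z => by positivity) ?_
      (.of_forall b1)).trans ?_
    · rw [integrable_indicator_iff measurableSet_closedBall]
      exact integrableOn_const (measure_closedBall_lt_top).ne
    · rw [integral_indicator measurableSet_closedBall, setIntegral_const, Measure.real,
        Complex.volume_closedBall]
      have : (ENNReal.ofReal (2 * R) ^ 2 * (NNReal.pi : ENNReal)).toReal = (2 * R) ^ 2 * π := by
        rw [ENNReal.toReal_mul, ENNReal.toReal_pow, ENNReal.toReal_ofReal (by positivity)]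
        rfl
      rw [this, hC0, smul_eq_mul, Real.mul_rpow (by norm_num) hRpos.le, neg_sub, Real.rpow_sub hRpos]
      apply le_of_eq
      rw [Real.rpow_two]
      field_simp
      ring
  have lim : Filter.Tendsto (fun R : ℝ => (∫ z, Real.exp (ϕ z) * ‖f z‖ ^ 2)
        + (3 ^ α * N ^ 2 * K ^ 2 * (4 * π)) * R ^ (-(2 - α))) Filter.atTop
      (nhds ((∫ z, Real.exp (ϕ z) * ‖f z‖ ^ 2) + (3 ^ α * N ^ 2 * K ^ 2 * (4 * π)) * 0)) :=
    ((tendsto_rpow_neg_atTop (by linarith)).const_mul _).const_add _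
  rw [mul_zero, add_zero] at lim
  exact ge_of_tendsto lim (Filter.eventually_atTop.2 ⟨2 * R0 + 1, fun R hR => main R (by linarith)⟩)

end DiracPlane
namespace DiracPlane

lemma antisymm_int {p q : ℂ → ℂ} (hp : Test p) (hq : Test q) :
    Integrable (Function.uncurry fun z t : ℂ => p z * (t⁻¹ * q (z - t))) (volume.prod volume) := by
  obtain ⟨R1, hR1⟩ := hp.radius
  obtain ⟨R2, hR2⟩ := hq.radius
  obtain ⟨C, hC⟩ := hq.1.continuous.bounded_above_of_compact_support hq.2
  set κ : ℂ → ℂ := (Metric.closedBall (0 : ℂ) (R1 + R2)).indicator (fun t => t⁻¹) with hκ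
  have hκi : Integrable κ := by
    rw [hκ, integrable_indicator_iff measurableSet_closedBall]
    exact locInt_cinv.integrableOn_isCompact (isCompact_closedBall _ _)
  have h1 : Integrable (fun x : ℂ × ℂ => p x.1 * κ x.2) (volume.prod volume) :=
    hp.integrable.mul_prod hκi
  have h2 : Integrable (fun x : ℂ × ℂ => (p x.1 * κ x.2) * q (x.1 - x.2)) (volume.prod volume) := by
    refine h1.mul_bdd (c := C) ?_ (.of_forall fun x => hC _)
    exact (hq.1.continuous.comp (continuous_fst.sub continuous_snd)).aestronglyMeasurable
  refine h2.congr (.of_forall fun x => ?_)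
  obtain ⟨z, t⟩ := x
  simp only [Function.uncurry_apply_pair]
  by_cases h1 : p z = 0
  · simp [h1]
  by_cases h2 : q (z - t) = 0
  · simp [h2]
  have : t ∈ Metric.closedBall (0 : ℂ) (R1 + R2) := by
    have := norm_sub_le z (z - t)
    rw [sub_sub_cancel] at this
    simpa using this.trans (add_le_add (hR1 _ h1) (hR2 _ h2))
  rw [hκ, Set.indicator_of_mem this, mul_assoc]

lemma antisymm {p q : ℂ → ℂ} (hp : Test p) (hq : Test q) :
    ∫ z, p z * Cau q z = -∫ z, q z * Cau p z := by
  have e : ∀ {p q : ℂ → ℂ}, Test p → Test q → ∫ z, p z * Cau q z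
      = (2 * (π : ℂ))⁻¹ * ∫ t : ℂ, t⁻¹ * ∫ z, p z * q (z - t) := by
    intro p q hp hq
    have h1 : ∀ z, p z * Cau q z = (2 * (π : ℂ))⁻¹ * ∫ t : ℂ, p z * (t⁻¹ * q (z - t)) := by
      intro z
      rw [Cau, cv_apply, integral_const_mul]; ring
    simp only [h1]
    rw [integral_const_mul, integral_integral_swap (antisymm_int hp hq)]
    congr 1
    refine integral_congr_ae (.of_forall fun t => ?_)
    simp only
    rw [← integral_const_mul]
    refine integral_congr_ae (.of_forall fun z => ?_)
    simp only; ring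
  rw [e hp hq, e hq hp, ← mul_neg, ← integral_neg]
  congr 1
  rw [← integral_neg_eq_self]
  refine integral_congr_ae (.of_forall fun t => ?_)
  simp only
  have : ∫ z, q z * p (z - t) = ∫ z, p z * q (z - -t) := by
    rw [← integral_add_right_eq_self (fun z => q z * p (z - t)) t]
    refine integral_congr_ae (.of_forall fun z => ?_)
    simp only [add_sub_cancel_right, sub_neg_eq_add]; ring
  rw [this, inv_neg]; ring

lemma seq_lemma {Q H : ℕ → ℝ} {c K : ℝ} (hQ : ∀ n, 0 ≤ Q n)
    (hconv : ∀ n, Q (n + 1) ^ 2 ≤ Q n * Q (n + 2)) (hc : 0 < c) (hK : 0 ≤ K)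
    (hKH : ∀ n, Q (n + 1) ≤ K * H n) (hH : ∀ n, c * H (n + 1) ≤ H n) : c * Q 1 ≤ Q 0 := by
  by_contra hcon
  push Not at hcon
  have h1 : 0 < Q 1 := by
    by_contra h
    have : c * Q 1 ≤ 0 := mul_nonpos_of_nonneg_of_nonpos hc.le (not_lt.1 h)
    linarith [hQ 0]
  have h0 : 0 < Q 0 := by
    rcases (hQ 0).lt_or_eq with h | h
    · exact h
    · have := hconv 0
      simp only [zero_add] at this
      rw [← h, zero_mul] at this
      nlinarith
  set r := Q 1 / Q 0 with hr
  have hr0 : 0 < r := by positivity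
  have hrc : 1 < c * r := by
    rw [hr, mul_div_assoc', one_lt_div h0]; exact hcon
  have step : ∀ n, 0 < Q n ∧ r * Q n ≤ Q (n + 1) := by
    intro n
    induction n with
    | zero => exact ⟨h0, by rw [hr, div_mul_cancel₀ _ h0.ne']⟩
    | succ n ih =>
      have hp : 0 < Q (n + 1) := (mul_pos hr0 ih.1).trans_le ih.2
      refine ⟨hp, ?_⟩
      have := hconv n
      have h3 : Q n * (r * Q (n + 1)) ≤ Q n * Q (n + 1 + 1) := by nlinarith
      exact le_of_mul_le_mul_left h3 ih.1
  have low : ∀ n, r ^ n * Q 1 ≤ Q (n + 1) := by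
    intro n
    induction n with
    | zero => simp
    | succ n ih =>
      calc _ = r * (r ^ n * Q 1) := by ring
        _ ≤ r * Q (n + 1) := by gcongr
        _ ≤ _ := (step (n + 1)).2
  have up : ∀ n, c ^ n * H n ≤ H 0 := by
    intro n
    induction n with
    | zero => simp
    | succ n ih =>
      calc _ = c ^ n * (c * H (n + 1)) := by ring
        _ ≤ c ^ n * H n := by gcongr; exact hH n
        _ ≤ _ := ih
  obtain ⟨n, hn⟩ := pow_unbounded_of_one_lt (K * H 0 / Q 1) hrc
  rw [div_lt_iff₀ h1] at hn
  have : (c * r) ^ n * Q 1 ≤ K * H 0 := by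
    calc _ = c ^ n * (r ^ n * Q 1) := by rw [mul_pow]; ring
      _ ≤ c ^ n * (K * H n) :=
        mul_le_mul_of_nonneg_left ((low n).trans (hKH n)) (by positivity)
      _ = K * (c ^ n * H n) := by ring
      _ ≤ _ := mul_le_mul_of_nonneg_left (up n) hK
  linarith

/-- the iteration -/
noncomputable def G (ρ : ℂ → ℝ) (g0 : ℂ → ℂ) : ℕ → ℂ → ℂ
  | 0 => g0
  | n + 1 => Cau (fun z => ρ z * (starRingEnd ℂ) (G ρ g0 n z))

lemma rho_test {ρ : ℂ → ℝ} (hρ : Test ρ) {g : ℂ → ℂ} (hg : ContDiff ℝ (⊤ : ℕ∞) g) :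
    Test (fun z => (ρ z : ℂ) * (starRingEnd ℂ) (g z)) := by
  have := Test.mul_left (smooth_conj hg) hρ.ofReal
  simpa only [mul_comm] using this

lemma G_smooth {ρ : ℂ → ℝ} (hρ : Test ρ) {g0 : ℂ → ℂ} (hg : ContDiff ℝ (⊤ : ℕ∞) g0) (n : ℕ) :
    ContDiff ℝ (⊤ : ℕ∞) (G ρ g0 n) := by
  induction n with
  | zero => exact hg
  | succ n ih => exact Cau_smooth (rho_test hρ ih)

lemma rho_int {ρ : ℂ → ℝ} (hρ : Test ρ) {w : ℂ → ℝ} (hw : Continuous w) :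
    Integrable (fun z => ρ z * w z) :=
  Continuous.integrable_of_hasCompactSupport (hρ.1.continuous.mul hw) hρ.2.mul_right

lemma G_conv {ρ : ℂ → ℝ} (hρ : Test ρ) (h0 : ∀ z, 0 ≤ ρ z) {g0 : ℂ → ℂ}
    (hg : ContDiff ℝ (⊤ : ℕ∞) g0) (n : ℕ) :
    (∫ z, ρ z * ‖G ρ g0 (n + 1) z‖ ^ 2) ^ 2
      ≤ (∫ z, ρ z * ‖G ρ g0 n z‖ ^ 2) * ∫ z, ρ z * ‖G ρ g0 (n + 2) z‖ ^ 2 := by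
  have s := fun k => G_smooth hρ hg k
  have cs := fun k => (s k).continuous
  have A := antisymm (rho_test hρ (s n)) (rho_test hρ (s (n + 1)))
  have e1 : ∫ z, ρ z * ((starRingEnd ℂ) (G ρ g0 n z) * G ρ g0 (n + 2) z).re
      = -∫ z, ρ z * ‖G ρ g0 (n + 1) z‖ ^ 2 := by
    have h1 := congrArg Complex.re A
    rw [Complex.neg_re] at h1
    have h2 : ∀ (v : ℂ → ℂ), Continuous v → (∫ z, (ρ z : ℂ) * v z).re = ∫ z, ρ z * (v z).re := by
      intro v hv
      have hi : Integrable (fun z => (ρ z : ℂ) * v z) :=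
        Continuous.integrable_of_hasCompactSupport (hρ.ofReal.1.continuous.mul hv)
          hρ.ofReal.2.mul_right
      have := integral_re hi
      simp only [RCLike.re_to_complex] at this
      rw [← this]
      simp
    simp only [mul_assoc] at h1
    have c1 := cs n
    have c2 := cs (n + 1)
    have c3 := cs (n + 2)
    change (∫ z, (ρ z : ℂ) * ((starRingEnd ℂ) (G ρ g0 n z) * G ρ g0 (n + 2) z)).re
      = -(∫ z, (ρ z : ℂ) * ((starRingEnd ℂ) (G ρ g0 (n + 1) z) * G ρ g0 (n + 1) z)).re at h1
    rw [h2 (fun z => (starRingEnd ℂ) (G ρ g0 n z) * G ρ g0 (n + 2) z)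
        ((Complex.continuous_conj.comp c1).mul c3),
      h2 (fun z => (starRingEnd ℂ) (G ρ g0 (n + 1) z) * G ρ g0 (n + 1) z)
        ((Complex.continuous_conj.comp c2).mul c2)] at h1
    rw [h1]
    congr 1
    refine integral_congr_ae (.of_forall fun z => ?_)
    simp only
    rw [mul_comm ((starRingEnd ℂ) _), Complex.mul_conj, Complex.ofReal_re, Complex.normSq_eq_norm_sq]
  have c1 := cs n
  have c3 := cs (n + 2)
  have key : ∀ x : ℝ, 0 ≤ (∫ z, ρ z * ‖G ρ g0 (n + 2) z‖ ^ 2) * (x * x)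
      + (2 * ∫ z, ρ z * ((starRingEnd ℂ) (G ρ g0 n z) * G ρ g0 (n + 2) z).re) * x
      + ∫ z, ρ z * ‖G ρ g0 n z‖ ^ 2 := by
    intro x
    have h1 : 0 ≤ ∫ z, ρ z * ‖G ρ g0 n z + x * G ρ g0 (n + 2) z‖ ^ 2 :=
      integral_nonneg fun z => mul_nonneg (h0 z) (by positivity)
    have h2 : ∀ z, ρ z * ‖G ρ g0 n z + x * G ρ g0 (n + 2) z‖ ^ 2
        = (x * x) * (ρ z * ‖G ρ g0 (n + 2) z‖ ^ 2)
          + (2 * x) * (ρ z * ((starRingEnd ℂ) (G ρ g0 n z) * G ρ g0 (n + 2) z).re)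
          + ρ z * ‖G ρ g0 n z‖ ^ 2 := by
      intro z
      simp only [← Complex.normSq_eq_norm_sq, Complex.normSq_apply, Complex.mul_re, Complex.mul_im,
        Complex.add_re, Complex.add_im, Complex.conj_re, Complex.conj_im, Complex.ofReal_re,
        Complex.ofReal_im]
      ring
    have i1 : Integrable (fun z => (x * x) * (ρ z * ‖G ρ g0 (n + 2) z‖ ^ 2)) :=
      (rho_int hρ (by fun_prop)).const_mul _
    have i2 : Integrable (fun z => (2 * x) *
        (ρ z * ((starRingEnd ℂ) (G ρ g0 n z) * G ρ g0 (n + 2) z).re)) :=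
      (rho_int hρ (Complex.continuous_re.comp
        ((Complex.continuous_conj.comp c1).mul c3))).const_mul _
    have i3 : Integrable (fun z => ρ z * ‖G ρ g0 n z‖ ^ 2) := rho_int hρ (by fun_prop)
    simp only [h2] at h1
    rw [integral_add (by exact i1.add i2) i3, integral_add i1 i2, integral_const_mul, integral_const_mul] at h1
    linarith
  have d := discrim_le_zero key
  rw [e1, discrim] at d
  nlinarith

lemma core {ρ : ℂ → ℝ} (hρ : Test ρ) (h0 : ∀ z, 0 ≤ ρ z) {g0 a : ℂ → ℂ}
    (hg : ContDiff ℝ (⊤ : ℕ∞) g0) (ha : Test a) {c : ℝ} (hc : 0 < c)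
    (hcM : c * ∫ z, ρ z ^ 2 < 4 * π) (hdb : ∀ z, db a z = ρ z * (starRingEnd ℂ) (g0 z)) :
    c * ∫ z, ρ z * ‖a z‖ ^ 2 ≤ ∫ z, ρ z * ‖g0 z‖ ^ 2 := by
  have s := fun k => G_smooth hρ hg k
  have cs := fun k => (s k).continuous
  have cρ := hρ.1.continuous
  have G1 : G ρ g0 1 = a := by
    funext z
    have : (fun z => ρ z * (starRingEnd ℂ) (g0 z)) = db a := funext fun z => (hdb z).symm
    change Cau (fun z => ρ z * (starRingEnd ℂ) (g0 z)) z = a z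
    rw [this, Cau_db ha]
  have hρ2 : Test (fun z => ρ z ^ 2) := ⟨hρ.1.pow 2, hρ.2.comp_left (g := fun x : ℝ => x ^ 2) (by simp)⟩
  set c' := (1 + ∫ z, ρ z)⁻¹ with hc'
  have hI : 0 ≤ ∫ z, ρ z := integral_nonneg h0
  have hc'0 : 0 < c' := by positivity
  have hc'M : c' * ∫ z, ρ z < 4 * π := by
    have : c' * ∫ z, ρ z ≤ 1 := by
      rw [hc', inv_mul_le_iff₀ (by positivity)]; linarith
    linarith [Real.pi_gt_three]
  set w := wt c (fun z => ρ z ^ 2) with hw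
  set w' := wt c' ρ with hw'
  have cw : Continuous w := (wt_smooth c hρ2).continuous
  have cw' : Continuous w' := (wt_smooth c' hρ).continuous
  obtain ⟨B1, hB1⟩ := hρ.2.isCompact.exists_bound_of_continuousOn
    (f := fun z => Real.exp (-w' z)) (by fun_prop)
  obtain ⟨B2, hB2⟩ := hρ.2.isCompact.exists_bound_of_continuousOn
    (f := fun z => Real.exp (w' z - w z)) (by fun_prop)
  set F : ℕ → ℂ → ℂ := fun n z => ρ z * (starRingEnd ℂ) (G ρ g0 n z) with hF
  have tF : ∀ n, Test (F n) := fun n => rho_test hρ (s n)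
  have cF := fun n => (tF n).1.continuous
  have mem : ∀ z, ρ z ≠ 0 → z ∈ tsupport ρ := fun z hz => subset_tsupport _ hz
  have hor1 : ∀ n, c * ∫ z, Real.exp (w z) * ‖F (n + 1) z‖ ^ 2
      ≤ ∫ z, Real.exp (w z) * ‖F n z‖ ^ 2 := by
    intro n
    refine le_trans (le_of_eq ?_) (hormander hρ2 (fun z => sq_nonneg _) hc hcM (tF n))
    congr 1
    refine integral_congr_ae (.of_forall fun z => ?_)
    have : ‖F (n + 1) z‖ ^ 2 = ρ z ^ 2 * ‖Cau (F n) z‖ ^ 2 := by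
      change ‖(ρ z : ℂ) * (starRingEnd ℂ) (Cau (F n) z)‖ ^ 2 = _
      rw [norm_mul, RCLike.norm_conj, Complex.norm_real, mul_pow, Real.norm_eq_abs, sq_abs]
    simp only
    rw [this]; ring
  have hor2 : ∀ n, c' * ∫ z, Real.exp (w' z) * ρ z * ‖G ρ g0 (n + 1) z‖ ^ 2
      ≤ ∫ z, Real.exp (w' z) * ‖F n z‖ ^ 2 := fun n => hormander hρ h0 hc'0 hc'M (tF n)
  have bd : ∀ n, ∫ z, ρ z * ‖G ρ g0 (n + 1) z‖ ^ 2
      ≤ (|B1| * c'⁻¹ * |B2|) * ∫ z, Real.exp (w z) * ‖F n z‖ ^ 2 := by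
    intro n
    have cn := cs (n + 1)
    have i1 : ∫ z, ρ z * ‖G ρ g0 (n + 1) z‖ ^ 2
        ≤ |B1| * ∫ z, Real.exp (w' z) * ρ z * ‖G ρ g0 (n + 1) z‖ ^ 2 := by
      rw [← integral_const_mul]
      refine integral_mono (rho_int hρ (by fun_prop)) ?_ fun z => ?_
      · refine Integrable.congr (rho_int hρ
          (w := fun z => |B1| * (Real.exp (w' z) * ‖G ρ g0 (n + 1) z‖ ^ 2)) (by fun_prop))
          (.of_forall fun z => ?_)
        simp only; ring
      · by_cases hz : ρ z = 0
        · simp [hz]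
        have h1 := (le_abs_self _).trans ((hB1 z (mem z hz)).trans (le_abs_self B1))
        have h2 : 1 ≤ |B1| * Real.exp (w' z) := by
          calc 1 = Real.exp (-w' z) * Real.exp (w' z) := by rw [← Real.exp_add]; simp
            _ ≤ _ := by gcongr
        have h3 : 0 ≤ ρ z * ‖G ρ g0 (n + 1) z‖ ^ 2 := mul_nonneg (h0 z) (by positivity)
        simp only
        nlinarith
    have i2 : ∫ z, Real.exp (w' z) * ‖F n z‖ ^ 2 ≤ |B2| * ∫ z, Real.exp (w z) * ‖F n z‖ ^ 2 := by
      rw [← integral_const_mul]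
      refine integral_mono (sq_int (by fun_prop) (cF n) (tF n).2)
        ((sq_int (by fun_prop) (cF n) (tF n).2).const_mul _) fun z => ?_
      by_cases hz : ρ z = 0
      · simp [hF, hz]
      have h1 := (le_abs_self _).trans ((hB2 z (mem z hz)).trans (le_abs_self B2))
      have h2 : Real.exp (w' z) ≤ |B2| * Real.exp (w z) := by
        calc _ = Real.exp (w' z - w z) * Real.exp (w z) := by rw [← Real.exp_add]; simp
          _ ≤ _ := by gcongr
      simp only
      rw [← mul_assoc]
      gcongr
    have i3 : ∫ z, Real.exp (w' z) * ρ z * ‖G ρ g0 (n + 1) z‖ ^ 2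
        ≤ c'⁻¹ * ∫ z, Real.exp (w' z) * ‖F n z‖ ^ 2 := by
      rw [le_inv_mul_iff₀ hc'0]; exact hor2 n
    calc _ ≤ _ := i1
      _ ≤ |B1| * (c'⁻¹ * (|B2| * ∫ z, Real.exp (w z) * ‖F n z‖ ^ 2)) := by
        gcongr
        refine i3.trans ?_
        gcongr
      _ = _ := by ring
  have := seq_lemma (Q := fun n => ∫ z, ρ z * ‖G ρ g0 n z‖ ^ 2)
    (H := fun n => ∫ z, Real.exp (w z) * ‖F n z‖ ^ 2) (c := c) (K := |B1| * c'⁻¹ * |B2|)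
    (fun n => integral_nonneg fun z => mul_nonneg (h0 z) (by positivity))
    (G_conv hρ h0 hg) hc (by positivity) bd hor1
  simp only [G1] at this
  exact this

end DiracPlane
namespace DiracPlane

lemma glue {F : Type*} [NormedAddCommGroup F] [NormedSpace ℝ F] {Ω : Set ℂ} (hΩ : IsOpen Ω)
    {w : ℂ → ℝ} (hw : ContDiffOn ℝ (⊤ : ℕ∞) w Ω) {f : ℂ → F} (hf : Test f)
    (hs : tsupport f ⊆ Ω) : Test (fun z => w z • f z) := by
  refine ⟨contDiff_iff_contDiffAt.2 fun z => ?_, hf.2.smul_left⟩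
  by_cases hz : z ∈ tsupport f
  · exact (hw.contDiffAt (hΩ.mem_nhds (hs hz))).smul hf.1.contDiffAt
  · have h1 : f =ᶠ[nhds z] 0 := notMem_tsupport_iff_eventuallyEq.1 hz
    refine (contDiffAt_const (c := (0 : F))).congr_of_eventuallyEq ?_
    filter_upwards [h1] with y hy
    simp [hy]

lemma cutoff {Ω K : Set ℂ} (hΩ : IsOpen Ω) (hK : IsCompact K) (h : K ⊆ Ω) :
    ∃ χ : ℂ → ℝ, Test χ ∧ tsupport χ ⊆ Ω ∧ (∀ z, 0 ≤ χ z) ∧ (∀ z, χ z ≤ 1) ∧ ∀ z ∈ K, χ z = 1 := by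
  obtain ⟨K', hK', h1, h2⟩ := exists_compact_between hK hΩ h
  obtain ⟨χ, c1, c2, c3, c4⟩ := exists_contMDiff_support_eq_eq_one_iff (n := ⊤)
    (modelWithCornersSelf ℝ ℂ) isOpen_interior hK.isClosed h1
  have h3 : tsupport χ ⊆ K' := closure_minimal (c3.le.trans interior_subset) hK'.isClosed
  refine ⟨χ, ⟨c1.contDiff, hK'.of_isClosed_subset isClosed_closure h3⟩, h3.trans h2,
    fun z => (c2 ⟨z, rfl⟩).1, fun z => (c2 ⟨z, rfl⟩).2, fun z hz => (c4 z).1 hz⟩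

lemma db_eq_zero {a : ℂ → ℂ} {z : ℂ} (hz : z ∉ tsupport a) : db a z = 0 := by
  have : fderiv ℝ a z = 0 := by
    by_contra h
    exact hz (support_fderiv_subset ℝ h)
  simp [db, this]

lemma tsupport_db (a : ℂ → ℂ) : tsupport (db a) ⊆ tsupport a := by
  refine closure_minimal (fun z hz => ?_) isClosed_closure
  by_contra h
  exact hz (db_eq_zero h)

lemma tsupport_conj (a : ℂ → ℂ) : tsupport (fun z => (starRingEnd ℂ) (a z)) ⊆ tsupport a := by
  refine closure_minimal (fun z hz => ?_) isClosed_closure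
  refine subset_tsupport _ fun h => hz ?_
  simp [h]

lemma Test.conj {a : ℂ → ℂ} (ha : Test a) : Test (fun z => (starRingEnd ℂ) (a z)) :=
  ⟨smooth_conj ha.1, ha.2.of_isClosed_subset isClosed_closure (tsupport_conj a)⟩

lemma int_on {Ω : Set ℂ} (hΩ : IsOpen Ω) {w : ℂ → ℝ} (hw : ContDiffOn ℝ (⊤ : ℕ∞) w Ω)
    {f : ℂ → ℂ} (hf : Test f) (hs : tsupport f ⊆ Ω) :
    Integrable (fun z => w z * ‖f z‖ ^ 2) := by
  have h1 := glue hΩ hw hf hs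
  have h2 : Continuous fun z => w z • f z := h1.1.continuous
  have h3 : Integrable (fun z => ‖f z‖ * ‖w z • f z‖) := by
    refine Continuous.integrable_of_hasCompactSupport (by have := hf.1.continuous; fun_prop) ?_
    exact hf.2.norm.mul_right
  have h4 : Continuous fun z => ((starRingEnd ℂ) (f z) * (w z • f z)).re :=
    Complex.continuous_re.comp ((Complex.continuous_conj.comp hf.1.continuous).mul h2)
  have h5 : Integrable fun z => ((starRingEnd ℂ) (f z) * (w z • f z)).re := by
    refine h3.mono' h4.aestronglyMeasurable (.of_forall fun z => ?_)
    refine (Complex.abs_re_le_norm _).trans ?_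
    rw [norm_mul, RCLike.norm_conj]
  refine h5.congr (.of_forall fun z => ?_)
  simp only [← Complex.normSq_eq_norm_sq, Complex.normSq_apply, Complex.mul_re, Complex.real_smul,
    Complex.mul_im, Complex.conj_re, Complex.conj_im, Complex.ofReal_re, Complex.ofReal_im]
  ring

lemma scalar {Ω : Set ℂ} (hΩ : IsOpen Ω) {u : ℂ → ℝ} (hu : ContDiffOn ℝ (⊤ : ℕ∞) u Ω)
    (hint : IntegrableOn (fun z => Real.exp (2 * u z)) Ω)
    (hA : 0 < ∫ z in Ω, Real.exp (2 * u z)) {a : ℂ → ℂ} (ha : Test a) (hs : tsupport a ⊆ Ω) :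
    (4 * π / ∫ z in Ω, Real.exp (2 * u z)) * ∫ z in Ω, Real.exp (u z) * ‖a z‖ ^ 2
      ≤ ∫ z in Ω, Real.exp (-u z) * ‖db a z‖ ^ 2 := by
  obtain ⟨χ, tχ, sχ, χ0, χ1, χe⟩ := cutoff hΩ ha.2.isCompact hs
  set A := ∫ z in Ω, Real.exp (2 * u z) with hAdef
  set ρ : ℂ → ℝ := fun z => Real.exp (u z) • χ z with hρdef
  have hρ : Test ρ := glue hΩ hu.exp tχ sχ
  have ρ0 : ∀ z, 0 ≤ ρ z := fun z => mul_nonneg (Real.exp_pos _).le (χ0 z)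
  set g0 : ℂ → ℂ := fun z => Real.exp (-u z) • (starRingEnd ℂ) (db a z) with hg0
  have hg : Test g0 := glue hΩ hu.neg.exp ha.db.conj
    (((tsupport_conj _).trans (tsupport_db a)).trans hs)
  have ρe : ∀ z, z ∈ tsupport a → ρ z = Real.exp (u z) := fun z hz => by
    simp [hρdef, χe z hz]
  have hdb : ∀ z, db a z = ρ z * (starRingEnd ℂ) (g0 z) := by
    intro z
    by_cases hz : z ∈ tsupport a
    · rw [ρe z hz, hg0]
      simp only [Complex.real_smul, map_mul, Complex.conj_ofReal, Complex.conj_conj]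
      rw [← mul_assoc, ← Complex.ofReal_mul, ← Real.exp_add]
      simp
    · simp [hg0, db_eq_zero hz]
  have X : ∫ z in Ω, Real.exp (u z) * ‖a z‖ ^ 2 = ∫ z, ρ z * ‖a z‖ ^ 2 := by
    rw [setIntegral_eq_integral_of_forall_compl_eq_zero]
    · refine integral_congr_ae (.of_forall fun z => ?_)
      simp only
      by_cases hz : z ∈ tsupport a
      · rw [ρe z hz]
      · simp [image_eq_zero_of_notMem_tsupport hz]
    · intro z hz
      simp [image_eq_zero_of_notMem_tsupport fun h => hz (hs h)]
  have Y : ∫ z in Ω, Real.exp (-u z) * ‖db a z‖ ^ 2 = ∫ z, ρ z * ‖g0 z‖ ^ 2 := by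
    rw [setIntegral_eq_integral_of_forall_compl_eq_zero]
    · refine integral_congr_ae (.of_forall fun z => ?_)
      simp only
      by_cases hz : z ∈ tsupport a
      · rw [ρe z hz, hg0]
        simp only [norm_smul, RCLike.norm_conj, Real.norm_eq_abs, Real.abs_exp]
        rw [mul_pow, ← mul_assoc]
        congr 1
        rw [sq, ← Real.exp_add, ← Real.exp_add]
        congr 1; ring
      · simp [hg0, db_eq_zero hz]
    · intro z hz
      simp [db_eq_zero fun h => hz (hs h)]
  have M : ∫ z, ρ z ^ 2 ≤ A := by
    rw [← setIntegral_eq_integral_of_forall_compl_eq_zero (s := Ω)]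
    · have hi : Integrable (fun z => ρ z ^ 2) := by
        have := rho_int hρ hρ.1.continuous
        simpa only [sq] using this
      refine setIntegral_mono hi.integrableOn hint fun z => ?_
      simp only [hρdef, smul_eq_mul]
      rw [mul_pow, ← Real.exp_nat_mul]
      have h1 : χ z ^ 2 ≤ 1 := pow_le_one₀ (χ0 z) (χ1 z)
      have h2 := Real.exp_pos (2 * u z)
      push_cast
      nlinarith
    · intro z hz
      have : χ z = 0 := image_eq_zero_of_notMem_tsupport fun h => hz (sχ h)
      simp [hρdef, this]
  rw [X, Y]
  have Y0 : 0 ≤ ∫ z, ρ z * ‖g0 z‖ ^ 2 := integral_nonneg fun z => mul_nonneg (ρ0 z) (by positivity)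
  have X0 : 0 ≤ ∫ z, ρ z * ‖a z‖ ^ 2 := integral_nonneg fun z => mul_nonneg (ρ0 z) (by positivity)
  by_contra hcon
  push Not at hcon
  have X1 : 0 < ∫ z, ρ z * ‖a z‖ ^ 2 := by
    rcases X0.lt_or_eq with h | h
    · exact h
    · rw [← h, mul_zero] at hcon; linarith
  rw [← div_lt_iff₀ X1] at hcon
  obtain ⟨c, hc1, hc2⟩ := exists_between hcon
  have hc : 0 < c := lt_of_le_of_lt (by positivity) hc1
  rw [lt_div_iff₀ hA] at hc2
  have := core hρ ρ0 hg.1 ha hc (lt_of_le_of_lt (mul_le_mul_of_nonneg_left M hc.le) hc2) hdb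
  rw [div_lt_iff₀ X1] at hc1
  linarith

lemma clifford_basis (c : Fin 2 → EuclideanSpace ℂ (Fin 2) →L[ℂ] EuclideanSpace ℂ (Fin 2))
    (hcliff : ∀ i j : Fin 2, ∀ v : EuclideanSpace ℂ (Fin 2),
      c i (c j v) + c j (c i v) = if i = j then (-2 : ℂ) • v else 0)
    (hskew : ∀ i : Fin 2, ∀ v w : EuclideanSpace ℂ (Fin 2), ⟪c i v, w⟫ = -⟪v, c i w⟫) :
    ∃ e f : EuclideanSpace ℂ (Fin 2), (∀ v : EuclideanSpace ℂ (Fin 2), ‖v‖ ^ 2 = ‖⟪e, v⟫‖ ^ 2 + ‖⟪f, v⟫‖ ^ 2) ∧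
      c 0 e = f ∧ c 0 f = -e ∧ c 1 e = Complex.I • f ∧ c 1 f = Complex.I • e := by
  have sq : ∀ i v, c i (c i v) = -v := by
    intro i v
    have h := hcliff i i v
    rw [if_pos rfl, ← two_smul ℂ, neg_smul, ← smul_neg] at h
    exact smul_right_injective _ (two_ne_zero (α := ℂ)) h
  have ac : ∀ v, c 1 (c 0 v) = -c 0 (c 1 v) := by
    intro v
    have h := hcliff 1 0 v
    rw [if_neg (by decide)] at h
    exact eq_neg_of_add_eq_zero_left h
  have ex : ∃ e : EuclideanSpace ℂ (Fin 2), e ≠ 0 ∧ c 0 (c 1 e) = -(Complex.I • e) := by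
    obtain ⟨v, hv⟩ := exists_ne (0 : EuclideanSpace ℂ (Fin 2))
    by_cases h : v + Complex.I • c 0 (c 1 v) = 0
    · refine ⟨c 0 v, fun h0 => hv ?_, ?_⟩
      · have := sq 0 v
        rw [h0, map_zero] at this
        exact neg_eq_zero.1 this.symm
      · have h1 := congrArg (c 0) h
        rw [map_add, map_smul, sq, map_zero, smul_neg] at h1
        have h2 : c 0 v = Complex.I • c 1 v := by rw [← sub_eq_add_neg] at h1; exact sub_eq_zero.1 h1
        rw [ac, map_neg, sq, neg_neg, h2, smul_smul, Complex.I_mul_I]; simp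
    · refine ⟨_, h, ?_⟩
      simp only [map_add, map_smul, ac, sq, map_neg, smul_add, smul_smul, Complex.I_mul_I]
      simp
  obtain ⟨e0, he0, hce0⟩ := ex
  have hn : ((‖e0‖ : ℝ) : ℂ) ≠ 0 := by simpa using he0
  set e : EuclideanSpace ℂ (Fin 2) := ((‖e0‖ : ℝ) : ℂ)⁻¹ • e0 with hedef
  have en : ‖e‖ = 1 := by
    rw [hedef, norm_smul, norm_inv, Complex.norm_real, norm_norm]
    exact inv_mul_cancel₀ (norm_ne_zero_iff.2 he0)
  have hce : c 0 (c 1 e) = -(Complex.I • e) := by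
    rw [hedef, map_smul, map_smul, hce0, smul_neg, smul_comm]
  clear_value e
  have c1e : c 1 e = Complex.I • c 0 e := by
    have h1 := congrArg (c 0) hce
    rw [sq, map_neg, map_smul] at h1
    exact neg_injective h1
  have c1f : c 1 (c 0 e) = Complex.I • e := by rw [ac, hce, neg_neg]
  have fn : ‖c 0 e‖ = 1 := by
    have h1 := hskew 0 e (c 0 e)
    rw [sq, inner_neg_right, neg_neg, inner_self_eq_norm_sq_to_K, inner_self_eq_norm_sq_to_K, en] at h1
    have h2 : ‖c 0 e‖ ^ 2 = 1 := by
      have : ((‖c 0 e‖ : ℝ) : ℂ) ^ 2 = ((1 : ℝ) : ℂ) := by simpa using h1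
      exact_mod_cast this
    nlinarith [norm_nonneg (c 0 e)]
  have orth : ⟪e, c 0 e⟫ = 0 := by
    have h1 := hskew 1 e e
    rw [c1e, inner_smul_left, inner_smul_right] at h1
    have h2 := hskew 0 e e
    rw [h2] at h1
    simp only [Complex.conj_I] at h1
    have h3 : Complex.I * ⟪e, c 0 e⟫ = 0 := by linear_combination (1 / 2 : ℂ) * h1
    exact (mul_eq_zero.1 h3).resolve_left Complex.I_ne_zero
  have orth2 : ⟪c 0 e, e⟫ = 0 := by rw [hskew, orth, neg_zero]
  have on : Orthonormal ℂ ![e, c 0 e] := by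
    rw [orthonormal_iff_ite]
    intro i j
    fin_cases i <;> fin_cases j <;>
      simp [orth, orth2, inner_self_eq_norm_sq_to_K, en, fn]
  let B := OrthonormalBasis.mk on (by
    rw [on.linearIndependent.span_eq_top_of_card_eq_finrank (by simp)])
  refine ⟨e, c 0 e, fun v => ?_, rfl, sq 0 e, c1e, c1f⟩
  have := B.sum_sq_norm_inner_right v
  simp only [B, OrthonormalBasis.coe_mk, Fin.sum_univ_two] at this
  simpa using this.symm

end DiracPlane
namespace DiracPlane

/-- the identification of the complex plane with the Euclidean plane -/
noncomputable def pl : ℂ ≃ₗᵢ[ℝ] EuclideanSpace ℝ (Fin 2) := Complex.orthonormalBasisOneI.repr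

lemma pl_one : pl 1 = EuclideanSpace.single 0 1 := by
  have := Complex.orthonormalBasisOneI.repr_self 0
  simpa [pl] using this

lemma pl_I : pl Complex.I = EuclideanSpace.single 1 1 := by
  have := Complex.orthonormalBasisOneI.repr_self 1
  simpa [pl] using this

lemma pl_setIntegral (Ω : Set (EuclideanSpace ℝ (Fin 2))) (g : EuclideanSpace ℝ (Fin 2) → ℝ) :
    ∫ x in Ω, g x = ∫ z in pl ⁻¹' Ω, g (pl z) :=
  (pl.measurePreserving.setIntegral_preimage_emb
    pl.toHomeomorph.measurableEmbedding g Ω).symm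

/-- components of a spinor -/
noncomputable def comp (e : EuclideanSpace ℂ (Fin 2))
    (φ : EuclideanSpace ℝ (Fin 2) → EuclideanSpace ℂ (Fin 2)) (z : ℂ) : ℂ := ⟪e, φ (pl z)⟫

variable {φ : EuclideanSpace ℝ (Fin 2) → EuclideanSpace ℂ (Fin 2)}

lemma pl_smooth : ContDiff ℝ (⊤ : ℕ∞) (fun z => pl z) :=
  pl.toContinuousLinearEquiv.toContinuousLinearMap.contDiff

lemma comp_smooth (e : EuclideanSpace ℂ (Fin 2)) (hφ : ContDiff ℝ (⊤ : ℕ∞) φ) :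
    ContDiff ℝ (⊤ : ℕ∞) (comp e φ) :=
  ((innerSL ℂ e).restrictScalars ℝ).contDiff.comp (hφ.comp pl_smooth)

lemma comp_fderiv (e : EuclideanSpace ℂ (Fin 2)) (hφ : ContDiff ℝ (⊤ : ℕ∞) φ) (z w : ℂ) :
    fderiv ℝ (comp e φ) z w = ⟪e, fderiv ℝ φ (pl z) (pl w)⟫ := by
  have h1 : HasFDerivAt (fun z => pl z) (pl.toContinuousLinearEquiv.toContinuousLinearMap) z :=
    pl.toContinuousLinearEquiv.toContinuousLinearMap.hasFDerivAt
  have h2 : HasFDerivAt φ (fderiv ℝ φ (pl z)) (pl z) :=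
    ((hφ.differentiable (by simp)) (pl z)).hasFDerivAt
  have h3 := ((innerSL ℂ e).restrictScalars ℝ).hasFDerivAt.comp z (h2.comp z h1)
  have h4 : fderiv ℝ (comp e φ) z = _ := h3.fderiv
  rw [h4]
  rfl

lemma comp_support (e : EuclideanSpace ℂ (Fin 2)) : tsupport (comp e φ) ⊆ pl ⁻¹' tsupport φ := by
  refine closure_minimal (fun z hz => subset_tsupport _ fun h => hz ?_)
    (isClosed_closure.preimage pl.continuous)
  simp [comp, h]

lemma comp_test (e : EuclideanSpace ℂ (Fin 2)) (hφ : ContDiff ℝ (⊤ : ℕ∞) φ)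
    (hφc : HasCompactSupport φ) : Test (comp e φ) :=
  ⟨comp_smooth e hφ, (pl.toHomeomorph.isCompact_preimage.2 hφc.isCompact).of_isClosed_subset
    isClosed_closure (comp_support e)⟩

end DiracPlane

open DiracPlane

theorem conformal_planar_dirac_lower_bound
    (c : Fin 2 → EuclideanSpace ℂ (Fin 2) →L[ℂ] EuclideanSpace ℂ (Fin 2))
    (hcliff : ∀ i j : Fin 2, ∀ v : EuclideanSpace ℂ (Fin 2),
      c i (c j v) + c j (c i v) = if i = j then (-2 : ℂ) • v else 0)
    (hskew : ∀ i : Fin 2, ∀ v w : EuclideanSpace ℂ (Fin 2), ⟪c i v, w⟫ = -⟪v, c i w⟫)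
    (Ω : Set (EuclideanSpace ℝ (Fin 2))) (hΩ : IsOpen Ω)
    (u : EuclideanSpace ℝ (Fin 2) → ℝ) (hu : ContDiffOn ℝ (⊤ : ℕ∞) u Ω)
    (hint : IntegrableOn (fun x => exp (2 * u x)) Ω volume)
    (hA : 0 < ∫ x in Ω, exp (2 * u x))
    (φ : EuclideanSpace ℝ (Fin 2) → EuclideanSpace ℂ (Fin 2))
    (hφ : ContDiff ℝ (⊤ : ℕ∞) φ) (hφc : HasCompactSupport φ) (hφΩ : tsupport φ ⊆ Ω)
    (Dφ : EuclideanSpace ℝ (Fin 2) → EuclideanSpace ℂ (Fin 2))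
    (hDφ : ∀ x, Dφ x = c 0 (fderiv ℝ φ x (EuclideanSpace.single 0 1))
        + c 1 (fderiv ℝ φ x (EuclideanSpace.single 1 1))) :
    (4 * π / ∫ x in Ω, exp (2 * u x)) * ∫ x in Ω, exp (u x) * ‖φ x‖ ^ 2
      ≤ ∫ x in Ω, exp (-u x) * ‖Dφ x‖ ^ 2 := by
  obtain ⟨e, f, pars, c0e, c0f, c1e, c1f⟩ := clifford_basis c hcliff hskew
  have hO : IsOpen (pl ⁻¹' Ω) := hΩ.preimage pl.continuous
  have hu' : ContDiffOn ℝ (⊤ : ℕ∞) (fun z => u (pl z)) (pl ⁻¹' Ω) :=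
    hu.comp pl_smooth.contDiffOn fun z hz => hz
  have hint' : IntegrableOn (fun z => Real.exp (2 * u (pl z))) (pl ⁻¹' Ω) :=
    (pl.measurePreserving.integrableOn_comp_preimage
      pl.toHomeomorph.measurableEmbedding).2 hint
  rw [pl_setIntegral] at hA
  simp only [pl_setIntegral Ω]
  set a := comp e φ with ha
  set b : ℂ → ℂ := fun z => (starRingEnd ℂ) (comp f φ z) with hb
  have ta : Test a := comp_test e hφ hφc
  have tb0 : Test (comp f φ) := comp_test f hφ hφc
  have tb : Test b := tb0.conj
  have sa : tsupport a ⊆ pl ⁻¹' Ω := (comp_support e).trans (Set.preimage_mono hφΩ)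
  have sb : tsupport b ⊆ pl ⁻¹' Ω :=
    ((tsupport_conj _).trans (comp_support f)).trans (Set.preimage_mono hφΩ)
  have Sa := scalar hO hu' hint' hA ta sa
  have Sb := scalar hO hu' hint' hA tb sb
  have n1 : ∀ z, ‖φ (pl z)‖ ^ 2 = ‖a z‖ ^ 2 + ‖b z‖ ^ 2 := by
    intro z
    rw [pars, hb, RCLike.norm_conj]; rfl
  have n2 : ∀ z, ‖Dφ (pl z)‖ ^ 2 = ‖db a z‖ ^ 2 + ‖db b z‖ ^ 2 := by
    intro z
    have h1 : ⟪f, Dφ (pl z)⟫ = db a z := by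
      have s0 := hskew 0 f (fderiv ℝ φ (pl z) (pl 1))
      have s1 := hskew 1 f (fderiv ℝ φ (pl z) (pl Complex.I))
      rw [c0f, inner_neg_left] at s0
      rw [c1f, inner_smul_left, Complex.conj_I] at s1
      rw [hDφ, ← pl_one, ← pl_I, inner_add_right, db, ha, comp_fderiv e hφ, comp_fderiv e hφ]
      linear_combination s0 + s1
    have h2 : ⟪e, Dφ (pl z)⟫ = -(starRingEnd ℂ) (db b z) := by
      have s0 := hskew 0 e (fderiv ℝ φ (pl z) (pl 1))
      have s1 := hskew 1 e (fderiv ℝ φ (pl z) (pl Complex.I))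
      rw [c0e] at s0
      rw [c1e, inner_smul_left, Complex.conj_I] at s1
      rw [hDφ, ← pl_one, ← pl_I, inner_add_right, db, hb, fderiv_conj tb0.1, fderiv_conj tb0.1,
        comp_fderiv f hφ, comp_fderiv f hφ, map_add, map_mul, Complex.conj_conj, Complex.conj_conj,
        Complex.conj_I]
      linear_combination s0 + s1
    rw [pars, h1, h2, norm_neg, RCLike.norm_conj]; ring
  simp only [n1, n2, mul_add]
  rw [integral_add (int_on hO hu'.exp ta sa).integrableOn (int_on hO hu'.exp tb sb).integrableOn,
    integral_add (int_on hO hu'.neg.exp ta.db ((tsupport_db a).trans sa)).integrableOn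
      (int_on hO hu'.neg.exp tb.db ((tsupport_db b).trans sb)).integrableOn, mul_add]
  exact add_le_add Sa Sb
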